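/- (Proposition 3, non-interacting form.) Let d ≥ 2. There exists a function ᾱ : (0,1) → (0,∞), depending only on d, such that the following holds. Let Λ ⊆ ℤ^d be finite, let V^↑, V^↓ : Λ → [0,∞) be a magnetic potential with A_↑ ∩ A_↓ = ∅, A_↑ and A_↓ nonempty, and V₀ > 2d(√d + 1), and let N be an integer with 0 < N ≤ |A| and ρ = N/|A| < 1. Define E(N) = min{ S_{N↑}(h_{V^↑}) + S_{N↓}(h_{V^↓}) : N↑ + N↓ = N, 0 ≤ N↑ ≤ |Λ|, 0 ≤ N↓ ≤ |Λ| }. Then e(ρ)·|A| − (e(ρ)/(2d))·(B(A_↑) + B(A_↓)) ≥ E(N) ≥ e(ρ)·|A| + (ᾱ(ρ) − γ(V₀))·(B(A_↑) + B(A_↓)), where γ(V₀) = 4d/(V₀ − 2d) + 16d³/((V₀ − 2d)² − 4d³). -/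

import Mathlib

open MeasureTheory
open scoped Classical

/-- The tight-binding dispersion relation `ε(k) = -2 Σᵢ cos kᵢ`. -/
noncomputable def eps (d : ℕ) (k : Fin d → ℝ) : ℝ := -2 * ∑ i, Real.cos (k i)

/-- `R(E) = (2π)^{-d} λ({k ∈ [-π,π]^d : ε(k) < E})`. -/
noncomputable def Rfun (d : ℕ) (E : ℝ) : ℝ :=
  (volume {k : Fin d → ℝ | (∀ i, k i ∈ Set.Icc (-Real.pi) Real.pi) ∧ eps d k < E}).toReal
    / (2 * Real.pi) ^ d

/-- `(2π)^{-d} ∫_{k ∈ [-π,π]^d, ε(k) < E} ε(k) dk`. -/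
noncomputable def en (d : ℕ) (E : ℝ) : ℝ :=
  (∫ k in {k : Fin d → ℝ | (∀ i, k i ∈ Set.Icc (-Real.pi) Real.pi) ∧ eps d k < E},
    eps d k) / (2 * Real.pi) ^ d

/-- The `ℓ¹` distance `|x - y|₁ = Σᵢ |xᵢ - yᵢ|` on `ℤ^d`. -/
def dist1 {d : ℕ} (x y : Fin d → ℤ) : ℕ := ∑ i, (x i - y i).natAbs

/-- The boundary `B(A)`: the number of pairs `(x, y)` with `x ∈ A`, `y ∉ A`,
`|x - y|₁ = 1`. -/
noncomputable def bdry {d : ℕ} (A : Set (Fin d → ℤ)) : ℕ :=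
  Set.ncard {p : (Fin d → ℤ) × (Fin d → ℤ) | p.1 ∈ A ∧ p.2 ∉ A ∧ dist1 p.1 p.2 = 1}

/-- The sum of the `N` smallest eigenvalues (with multiplicity) of a real
symmetric matrix. -/
noncomputable def sumSmallest {n : Type*} [Fintype n] [DecidableEq n]
    (M : Matrix n n ℝ) (N : ℕ) : ℝ :=
  if h : M.IsHermitian then
    sInf ((fun s : Finset n => ∑ i ∈ s, h.eigenvalues i) '' {s : Finset n | s.card = N})
  else 0

/-- The one-particle tight-binding Hamiltonian `h_V` on `Λ`:
`(h_V)_{xy} = -1` if `|x-y|₁ = 1`, `(h_V)_{xx} = V(x)`, and `0` otherwise. -/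
noncomputable def hV (d : ℕ) (Λ : Finset (Fin d → ℤ)) (V : (Fin d → ℤ) → ℝ) :
    Matrix Λ Λ ℝ :=
  fun x y => if dist1 (x : Fin d → ℤ) (y : Fin d → ℤ) = 1 then -1
    else if (x : Fin d → ℤ) = (y : Fin d → ℤ) then V x else 0

/-- `S_N(h_V)`: the sum of the `N` smallest eigenvalues of `h_V`. -/
noncomputable def SN (d : ℕ) (Λ : Finset (Fin d → ℤ)) (V : (Fin d → ℤ) → ℝ) (N : ℕ) : ℝ :=
  sumSmallest (hV d Λ V) N

/-- `A_σ = {x ∈ Λ : V^σ(x) = 0}`. -/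
noncomputable def Aset (d : ℕ) (Λ : Finset (Fin d → ℤ)) (V : (Fin d → ℤ) → ℝ) :
    Finset (Fin d → ℤ) :=
  Λ.filter (fun x => V x = 0)

/-- `γ(V₀) = 4d/(V₀-2d) + 16d³/((V₀-2d)² - 4d³)`. -/
noncomputable def gam (d : ℕ) (V0 : ℝ) : ℝ :=
  4*(d:ℝ)/(V0 - 2*d) + 16*(d:ℝ)^3/((V0 - 2*d)^2 - 4*(d:ℝ)^3)

/-- The ground-state energy with `N` electrons of unspecified spin:
`E(N) = min { S_{N↑}(h_{V↑}) + S_{N↓}(h_{V↓}) : N↑ + N↓ = N, 0 ≤ N_σ ≤ |Λ| }`. -/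
noncomputable def EN (d : ℕ) (Λ : Finset (Fin d → ℤ))
    (Vup Vdn : (Fin d → ℤ) → ℝ) (N : ℕ) : ℝ :=
  sInf {r : ℝ | ∃ Nup Ndn : ℕ, Nup + Ndn = N ∧ Nup ≤ Λ.card ∧ Ndn ≤ Λ.card ∧
    r = SN d Λ Vup Nup + SN d Λ Vdn Ndn}

/-- The directed nearest-neighbour steps `±eᵢ` of `ℤ^d`. -/
def dir {d : ℕ} (p : Fin d × Bool) : Fin d → ℤ := Pi.single p.1 (if p.2 then 1 else -1)

/-- The character `k ↦ exp (i x·k)` of the Brillouin zone. -/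
noncomputable def chr {d : ℕ} (x : Fin d → ℤ) (k : Fin d → ℝ) : ℂ :=
  Complex.exp (((∑ i, (x i : ℝ) * k i : ℝ) : ℂ) * Complex.I)

/-- The box `[-π, π]^d`. -/
def box (d : ℕ) : Set (Fin d → ℝ) := Set.univ.pi fun _ => Set.Icc (-Real.pi) Real.pi

/-- Normalized Lebesgue measure on the Brillouin zone. -/
noncomputable def bz (d : ℕ) : Measure (Fin d → ℝ) :=
  ENNReal.ofReal (((2 * Real.pi) ^ d)⁻¹) • volume.restrict (box d)

section Characters

variable {d : ℕ}

lemma chr_add (x y : Fin d → ℤ) (k : Fin d → ℝ) : chr (x + y) k = chr x k * chr y k := by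
  simp only [chr, ← Complex.exp_add]
  congr 1
  simp [add_mul, Finset.sum_add_distrib]

lemma norm_chr (x : Fin d → ℤ) (k : Fin d → ℝ) : ‖chr x k‖ = 1 :=
  Complex.norm_exp_ofReal_mul_I _

lemma conj_chr (x : Fin d → ℤ) (k : Fin d → ℝ) :
    (starRingEnd ℂ) (chr x k) = chr (-x) k := by
  simp only [chr, ← Complex.exp_conj]
  congr 1
  simp

lemma chr_sub (x y : Fin d → ℤ) (k : Fin d → ℝ) :
    chr (x - y) k = chr x k * (starRingEnd ℂ) (chr y k) := by
  rw [conj_chr, ← chr_add, sub_eq_add_neg]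

lemma chr_sub_right (x : Fin d → ℤ) (k l : Fin d → ℝ) :
    chr x (k - l) = chr x k * (starRingEnd ℂ) (chr x l) := by
  simp only [chr, ← Complex.exp_conj, ← Complex.exp_add]
  congr 1
  simp [mul_sub, Finset.sum_sub_distrib]
  ring

lemma continuous_chr (x : Fin d → ℤ) : Continuous (chr x) := by
  unfold chr
  fun_prop

lemma chr_re (x : Fin d → ℤ) (k : Fin d → ℝ) :
    (chr x k).re = Real.cos (∑ i, (x i : ℝ) * k i) := Complex.exp_ofReal_mul_I_re _

lemma chr_dir_re (p : Fin d × Bool) (k : Fin d → ℝ) :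
    (chr (dir p) k).re = Real.cos (k p.1) := by
  rw [chr_re, Finset.sum_eq_single p.1]
  · rcases p with ⟨i, _ | _⟩ <;> simp [dir]
  · intro b _ hb
    simp [dir, hb]
  · simp

lemma eps_eq_sum_re (k : Fin d → ℝ) : eps d k = -∑ p : Fin d × Bool, (chr (dir p) k).re := by
  simp only [chr_dir_re, Fintype.sum_prod_type]
  simp [eps, Finset.mul_sum, two_mul, ← Finset.sum_neg_distrib]

lemma eps_eq_sum (k : Fin d → ℝ) : (eps d k : ℂ) = -∑ p : Fin d × Bool, chr (dir p) k := by
  have h (i : Fin d) : chr (dir (i, true)) k + chr (dir (i, false)) k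
      = ((2 * Real.cos (k i) : ℝ) : ℂ) := by
    have : dir (i, false) = -dir (i, true) := by
      simp [dir, Pi.single_neg]
    rw [this, ← conj_chr, Complex.add_conj, chr_dir_re]
  simp only [Fintype.sum_prod_type, Fintype.sum_bool, h]
  simp [eps, Finset.mul_sum]

lemma continuous_eps : Continuous (eps d) := by
  unfold eps
  fun_prop

end Characters

section Measure

variable {d : ℕ}

lemma isCompact_box : IsCompact (box d) := isCompact_univ_pi fun _ => isCompact_Icc

lemma measurableSet_box : MeasurableSet (box d) := isCompact_box.measurableSet

lemma volume_box : volume (box d) = ENNReal.ofReal ((2 * Real.pi) ^ d) := by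
  rw [box, volume_pi_pi]
  simp [Real.volume_Icc, ← two_mul, ENNReal.ofReal_pow (by positivity : (0:ℝ) ≤ 2 * Real.pi)]

instance : IsProbabilityMeasure (bz d) where
  measure_univ := by
    have h : (0:ℝ) < (2 * Real.pi) ^ d := by positivity
    simp only [bz, Measure.smul_apply, Measure.restrict_apply_univ, volume_box, smul_eq_mul]
    rw [← ENNReal.ofReal_mul (by positivity), inv_mul_cancel₀ h.ne', ENNReal.ofReal_one]

lemma ae_mem_box : ∀ᵐ k ∂(bz d), k ∈ box d :=
  Measure.ae_smul_measure (ae_restrict_mem measurableSet_box) _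

lemma integrable_bz {E : Type*} [NormedAddCommGroup E] [SecondCountableTopology E]
    {f : (Fin d → ℝ) → E} (hf : Continuous f) : Integrable f (bz d) := by
  obtain ⟨C, hC⟩ := isCompact_box.exists_bound_of_continuousOn (f := f) (s := box d)
    hf.continuousOn
  exact Integrable.of_bound hf.aestronglyMeasurable C (ae_mem_box.mono hC)

lemma integrable_bz_prod {f : (Fin d → ℝ) × (Fin d → ℝ) → ℝ} (hf : Continuous f) :
    Integrable f ((bz d).prod (bz d)) := by
  obtain ⟨C, hC⟩ := (isCompact_box.prod isCompact_box).exists_bound_of_continuousOn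
    (f := f) (s := box d ×ˢ box d) hf.continuousOn
  refine Integrable.of_bound hf.aestronglyMeasurable C ?_
  filter_upwards [Measure.quasiMeasurePreserving_fst.ae ae_mem_box,
    Measure.quasiMeasurePreserving_snd.ae ae_mem_box] with x h1 h2
  exact hC x ⟨h1, h2⟩

lemma integral_cexp_int (n : ℤ) :
    ∫ t in Set.Icc (-Real.pi) Real.pi, Complex.exp (((n : ℝ) * t : ℝ) * Complex.I)
      = if n = 0 then ((2 * Real.pi : ℝ) : ℂ) else 0 := by
  rw [integral_Icc_eq_integral_Ioc, ← intervalIntegral.integral_of_le (by linarith [Real.pi_pos])]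
  split_ifs with h
  · subst h
    simp [two_mul]
  · have hc : (n : ℂ) * Complex.I ≠ 0 := by simp [h]
    have h1 : ∀ t : ℝ, Complex.exp (((n : ℝ) * t : ℝ) * Complex.I)
        = Complex.exp ((n : ℂ) * Complex.I * t) := fun t => by
      congr 1; push_cast; ring
    simp only [h1]
    rw [integral_exp_mul_complex hc, div_eq_zero_iff]
    left
    rw [sub_eq_zero, Complex.exp_eq_exp_iff_exists_int]
    exact ⟨n, by push_cast; ring⟩

lemma integral_chr (x : Fin d → ℤ) : ∫ k, chr x k ∂(bz d) = if x = 0 then 1 else 0 := by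
  have h0 : (0:ℝ) < (2 * Real.pi) ^ d := by positivity
  have h1 : ∀ k : Fin d → ℝ, chr x k
      = ∏ i, Complex.exp (((x i : ℝ) * k i : ℝ) * Complex.I) := fun k => by
    rw [← Complex.exp_sum, chr]
    congr 1
    push_cast
    rw [Finset.sum_mul]
  rw [bz, integral_smul_measure, ENNReal.toReal_ofReal (by positivity), box, volume_pi,
    Measure.restrict_pi_pi]
  simp only [h1]
  rw [integral_fintype_prod_eq_prod (f := fun i (t : ℝ) =>
    Complex.exp (((x i : ℝ) * t : ℝ) * Complex.I))]
  simp only [integral_cexp_int]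
  split_ifs with h
  · subst h
    simp only [Pi.zero_apply, if_true, Finset.prod_const, Finset.card_univ, Fintype.card_fin]
    rw [← Complex.ofReal_pow, Complex.real_smul, ← Complex.ofReal_mul, inv_mul_cancel₀ h0.ne']
    simp
  · obtain ⟨i, hi⟩ := Function.ne_iff.mp h
    rw [Finset.prod_eq_zero (Finset.mem_univ i), smul_zero]
    simpa using hi

lemma Rfun_eq (E : ℝ) : Rfun d E = (bz d).real {k | eps d k < E} := by
  have hm : MeasurableSet {k : Fin d → ℝ | eps d k < E} :=
    measurableSet_lt continuous_eps.measurable measurable_const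
  rw [Measure.real, bz, Measure.smul_apply, Measure.restrict_apply hm, smul_eq_mul,
    ENNReal.toReal_mul, ENNReal.toReal_ofReal (by positivity), Rfun, div_eq_inv_mul]
  congr 3
  ext k
  simp only [box, Set.mem_inter_iff, Set.mem_ofPred_eq, Set.mem_univ_pi]
  exact and_comm

lemma en_eq (E : ℝ) : en d E = ∫ k in {k | eps d k < E}, eps d k ∂(bz d) := by
  have hm : MeasurableSet {k : Fin d → ℝ | eps d k < E} :=
    measurableSet_lt continuous_eps.measurable measurable_const
  rw [bz, Measure.restrict_smul, integral_smul_measure, Measure.restrict_restrict hm,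
    ENNReal.toReal_ofReal (by positivity), en, div_eq_inv_mul, smul_eq_mul]
  congr 3
  ext k
  simp only [box, Set.mem_inter_iff, Set.mem_ofPred_eq, Set.mem_univ_pi]
  exact and_comm

end Measure

section Sublevel

variable {d : ℕ}

lemma measurableSet_sublevel (E : ℝ) : MeasurableSet {k : Fin d → ℝ | eps d k < E} :=
  measurableSet_lt continuous_eps.measurable measurable_const

lemma countable_cos_eq (t : ℝ) : {a : ℝ | Real.cos a = t}.Countable := by
  rcases Set.eq_empty_or_nonempty {a : ℝ | Real.cos a = t} with h | ⟨b, hb⟩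
  · simp [h]
  · refine ((Set.countable_range fun n : ℤ => 2 * n * Real.pi + b).union
      (Set.countable_range fun n : ℤ => 2 * n * Real.pi - b)).mono ?_
    intro a ha
    obtain ⟨n, hn⟩ := (Real.cos_eq_cos_iff (x := b) (y := a)).mp (hb.trans ha.symm)
    rcases hn with h | h
    · exact Or.inl ⟨n, h.symm⟩
    · exact Or.inr ⟨n, h.symm⟩

lemma volume_level (n : ℕ) (E : ℝ) : volume {k : Fin (n + 1) → ℝ | eps (n + 1) k = E} = 0 := by
  have hp := volume_preserving_piFinSuccAbove (fun _ : Fin (n + 1) => ℝ) 0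
  have hm : MeasurableSet {q : ℝ × (Fin n → ℝ) | -2 * Real.cos q.1 + eps n q.2 = E} := by
    apply measurableSet_eq_fun _ measurable_const
    have := (continuous_eps (d := n)).measurable
    fun_prop
  have hset : {k : Fin (n + 1) → ℝ | eps (n + 1) k = E}
      = (MeasurableEquiv.piFinSuccAbove (fun _ : Fin (n + 1) => ℝ) 0) ⁻¹'
        {q : ℝ × (Fin n → ℝ) | -2 * Real.cos q.1 + eps n q.2 = E} := by
    ext k
    simp [eps, Fin.sum_univ_succ, mul_add, Fin.tail]
  rw [hset, hp.measure_preimage hm.nullMeasurableSet, Measure.volume_eq_prod,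
    Measure.prod_apply_symm hm]
  refine (lintegral_congr fun y => ?_).trans lintegral_zero
  refine ((countable_cos_eq ((eps n y - E) / 2)).mono fun a ha => ?_).measure_zero _
  have ha : -2 * Real.cos a + eps n y = E := ha
  change Real.cos a = _
  linarith

lemma bz_level (hd : 0 < d) (E : ℝ) : bz d {k | eps d k = E} = 0 := by
  obtain ⟨n, rfl⟩ := Nat.exists_eq_succ_of_ne_zero hd.ne'
  rw [bz, Measure.smul_apply]
  have h : volume.restrict (box (n + 1)) {k | eps (n + 1) k = E} = 0 :=
    Measure.absolutelyContinuous_of_le Measure.restrict_le_self (volume_level n E)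
  rw [Nat.succ_eq_add_one, h, smul_zero]

/-- Thin energy shells around a given level have arbitrarily small measure. -/
lemma exists_shell (hd : 0 < d) (E : ℝ) {c : ℝ} (hc : 0 < c) :
    ∃ δ > 0, (bz d).real {k | |eps d k - E| ≤ δ} ≤ c := by
  have hanti : Antitone fun n : ℕ => {k : Fin d → ℝ | |eps d k - E| ≤ 1 / ((n : ℝ) + 1)} :=
    fun m n hmn k (hk : |eps d k - E| ≤ 1 / ((n : ℝ) + 1)) =>
      (hk.trans (Nat.one_div_le_one_div hmn) : |eps d k - E| ≤ 1 / ((m : ℝ) + 1))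
  have hm : ∀ n : ℕ, NullMeasurableSet
      {k : Fin d → ℝ | |eps d k - E| ≤ 1 / ((n : ℝ) + 1)} (bz d) := fun n =>
    (measurableSet_le (continuous_eps.sub continuous_const).abs.measurable
      measurable_const).nullMeasurableSet
  have ht := tendsto_measure_iInter_atTop (μ := bz d) hm hanti ⟨0, measure_ne_top _ _⟩
  have hI : ⋂ n : ℕ, {k : Fin d → ℝ | |eps d k - E| ≤ 1 / ((n : ℝ) + 1)}
      = {k | eps d k = E} := by
    ext k
    simp only [Set.mem_iInter, Set.mem_ofPred_eq]
    constructor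
    · intro h
      have := ge_of_tendsto' tendsto_one_div_add_atTop_nhds_zero_nat h
      exact sub_eq_zero.mp (abs_nonpos_iff.mp this)
    · intro h n
      rw [h, sub_self, abs_zero]
      positivity
  rw [hI, bz_level hd] at ht
  obtain ⟨n, hn⟩ := ((tendsto_order.mp ht).2 (ENNReal.ofReal c) (by simpa using hc)).exists
  exact ⟨1 / ((n : ℝ) + 1), by positivity, ENNReal.toReal_le_of_le_ofReal hc.le hn.le⟩

lemma setIntegral_cos_eq (E : ℝ) (i j : Fin d) :
    ∫ k in {k | eps d k < E}, Real.cos (k i) ∂(bz d)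
      = ∫ k in {k | eps d k < E}, Real.cos (k j) ∂(bz d) := by
  have hp := volume_measurePreserving_piCongrLeft (fun _ : Fin d => ℝ) (Equiv.swap i j)
  have happ (k : Fin d → ℝ) (l : Fin d) : MeasurableEquiv.piCongrLeft (fun _ : Fin d => ℝ)
      (Equiv.swap i j) k l = k (Equiv.swap i j l) := by
    conv_lhs => rw [← Equiv.swap_apply_self i j l]
    exact MeasurableEquiv.piCongrLeft_apply_apply _ _ _
  simp only [bz, Measure.restrict_smul, integral_smul_measure,
    Measure.restrict_restrict (measurableSet_sublevel E)]
  congr 1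
  rw [← hp.setIntegral_preimage_emb (MeasurableEquiv.measurableEmbedding _)]
  simp only [happ, Equiv.swap_apply_left]
  congr 2
  ext k
  simp only [box, Set.mem_preimage, Set.mem_inter_iff, Set.mem_ofPred_eq, Set.mem_univ_pi,
    eps, happ]
  rw [Equiv.sum_comp (Equiv.swap i j) fun l => Real.cos (k l),
    (Equiv.swap i j).forall_congr_left]
  simp

/-- The first Fourier coefficient of a sublevel set is `-e / 2d`. -/
lemma setIntegral_cos (E : ℝ) (i : Fin d) :
    ∫ k in {k | eps d k < E}, Real.cos (k i) ∂(bz d) = -en d E / (2 * d) := by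
  have hd : (d : ℝ) ≠ 0 := Nat.cast_ne_zero.mpr (Fin.pos i).ne'
  have h : en d E = -2 * ∑ j : Fin d, ∫ k in {k | eps d k < E}, Real.cos (k j) ∂(bz d) := by
    rw [en_eq, ← integral_finsetSum, ← integral_const_mul]
    · rfl
    · exact fun j _ => (integrable_bz (by fun_prop)).integrableOn
  rw [h, Finset.sum_congr rfl fun j _ => setIntegral_cos_eq E j i]
  simp
  field_simp

lemma integral_eps : ∫ k, eps d k ∂(bz d) = 0 := by
  have hc (p : Fin d × Bool) : Continuous fun k : Fin d → ℝ => (chr (dir p) k).re :=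
    Complex.continuous_re.comp (continuous_chr _)
  simp only [eps_eq_sum_re]
  rw [integral_neg, integral_finsetSum _ fun p _ => integrable_bz (hc p), neg_eq_zero]
  refine Finset.sum_eq_zero fun p _ => ?_
  have h := integral_chr (dir p)
  rw [if_neg (by rcases p with ⟨i, _ | _⟩ <;> simp [dir])] at h
  have := integral_re (𝕜 := ℂ) (integrable_bz (continuous_chr (dir p)))
  rw [h] at this
  simpa using this

/-- The energy density of a partially filled band is negative. -/
lemma en_neg {E : ℝ} (h0 : 0 < Rfun d E) (h1 : Rfun d E < 1) : en d E < 0 := by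
  rw [Rfun_eq] at h0 h1
  have hint := integrable_bz (continuous_eps (d := d))
  have hm := measurableSet_sublevel (d := d) E
  have hcompl : (bz d).real {k | eps d k < E}ᶜ = 1 - (bz d).real {k | eps d k < E} :=
    probReal_compl_eq_one_sub hm
  have hsum := integral_add_compl hm hint
  rw [integral_eps, ← en_eq] at hsum
  have hlow : en d E ≤ E * (bz d).real {k | eps d k < E} := by
    rw [en_eq, mul_comm, ← smul_eq_mul, ← setIntegral_const]
    exact setIntegral_mono_on hint.integrableOn (integrable_const _).integrableOn hm
      fun k hk => le_of_lt hk
  have hhigh : E * (1 - (bz d).real {k | eps d k < E})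
      ≤ ∫ k in {k | eps d k < E}ᶜ, eps d k ∂(bz d) := by
    rw [← hcompl, mul_comm, ← smul_eq_mul, ← setIntegral_const]
    exact setIntegral_mono_on (integrable_const _).integrableOn hint.integrableOn hm.compl
      fun k hk => not_lt.mp hk
  rcases lt_trichotomy E 0 with hE | hE | hE
  · nlinarith
  · subst hE
    have hpos : 0 < ∫ k in {k | eps d k < 0}, -eps d k ∂(bz d) := by
      rw [setIntegral_pos_iff_support_of_nonneg_ae (f := fun k => -eps d k) _
        hint.neg.integrableOn]
      · refine lt_of_lt_of_le (ENNReal.toReal_pos_iff.mp h0).1 (measure_mono fun k hk => ⟨?_, hk⟩)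
        exact neg_ne_zero.mpr (ne_of_lt hk)
      · filter_upwards [ae_restrict_mem hm] with k hk
        exact neg_nonneg.mpr (le_of_lt hk)
    rw [integral_neg, ← en_eq] at hpos
    linarith
  · nlinarith

end Sublevel

section TrigPolynomials

variable {d : ℕ}

/-- The trigonometric polynomial `∑_{x ∈ Y} a x e^{ix·k}`. -/
noncomputable def trig (Y : Finset (Fin d → ℤ)) (a : (Fin d → ℤ) → ℂ) (k : Fin d → ℝ) : ℂ :=
  ∑ x ∈ Y, a x * chr x k

lemma continuous_trig (Y : Finset (Fin d → ℤ)) (a : (Fin d → ℤ) → ℂ) :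
    Continuous (trig Y a) :=
  continuous_finsetSum _ fun x _ => continuous_const.mul (continuous_chr x)

lemma sq_norm_trig (Y : Finset (Fin d → ℤ)) (a : (Fin d → ℤ) → ℂ) (k : Fin d → ℝ) :
    ((‖trig Y a k‖ ^ 2 : ℝ) : ℂ)
      = ∑ x ∈ Y, ∑ y ∈ Y, a x * (starRingEnd ℂ) (a y) * chr (x - y) k := by
  push_cast
  rw [← Complex.mul_conj', trig, map_sum, Finset.sum_mul_sum]
  refine Finset.sum_congr rfl fun x _ => Finset.sum_congr rfl fun y _ => ?_
  rw [chr_sub, map_mul]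
  ring

/-- The Fourier coefficients of the indicator function of `S`. -/
noncomputable def fc (S : Set (Fin d → ℝ)) (z : Fin d → ℤ) : ℂ := ∫ k in S, chr z k ∂(bz d)

lemma fc_univ (z : Fin d → ℤ) : fc Set.univ z = if z = 0 then 1 else 0 := by
  rw [fc, setIntegral_univ, integral_chr]

lemma fc_re (S : Set (Fin d → ℝ)) (z : Fin d → ℤ) :
    (fc S z).re = ∫ k in S, (chr z k).re ∂(bz d) :=
  (integral_re (𝕜 := ℂ) (integrable_bz (continuous_chr z)).integrableOn).symm

lemma setIntegral_sq_norm_trig (S : Set (Fin d → ℝ)) (Y : Finset (Fin d → ℤ))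
    (a : (Fin d → ℤ) → ℂ) :
    ((∫ k in S, ‖trig Y a k‖ ^ 2 ∂(bz d) : ℝ) : ℂ)
      = ∑ x ∈ Y, ∑ y ∈ Y, a x * (starRingEnd ℂ) (a y) * fc S (x - y) := by
  have hi (z : Fin d → ℤ) : IntegrableOn (chr z) S (bz d) :=
    (integrable_bz (continuous_chr z)).integrableOn
  rw [← integral_complex_ofReal]
  simp only [sq_norm_trig]
  rw [integral_finsetSum _ fun x _ => integrable_finsetSum _ fun y _ => (hi _).const_mul _]
  refine Finset.sum_congr rfl fun x _ => ?_
  rw [integral_finsetSum _ fun y _ => (hi _).const_mul _]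
  exact Finset.sum_congr rfl fun y _ => integral_const_mul _ _

lemma integral_sq_norm_trig (Y : Finset (Fin d → ℤ)) (a : (Fin d → ℤ) → ℂ) :
    ∫ k, ‖trig Y a k‖ ^ 2 ∂(bz d) = ∑ x ∈ Y, ‖a x‖ ^ 2 := by
  have h := setIntegral_sq_norm_trig Set.univ Y a
  rw [setIntegral_univ] at h
  apply Complex.ofReal_injective
  rw [h]
  push_cast
  refine Finset.sum_congr rfl fun x hx => ?_
  simp only [fc_univ, sub_eq_zero, mul_ite, mul_one, mul_zero]
  rw [Finset.sum_ite_eq, if_pos hx, Complex.mul_conj']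

lemma integrable_sq_norm_trig (Y : Finset (Fin d → ℤ)) (a : (Fin d → ℤ) → ℂ) :
    Integrable (fun k => ‖trig Y a k‖ ^ 2) (bz d) :=
  integrable_bz ((continuous_trig Y a).norm.pow 2)

lemma setIntegral_sq_norm_trig_le (S : Set (Fin d → ℝ)) (Y : Finset (Fin d → ℤ))
    (a : (Fin d → ℤ) → ℂ) :
    ∫ k in S, ‖trig Y a k‖ ^ 2 ∂(bz d) ≤ ∑ x ∈ Y, ‖a x‖ ^ 2 := by
  rw [← integral_sq_norm_trig]
  exact setIntegral_le_integral (integrable_sq_norm_trig Y a)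
    (Filter.Eventually.of_forall fun k => by positivity)

/-- The kinetic energy of a finitely supported function in momentum space. -/
lemma integral_sq_norm_trig_mul_eps (Y : Finset (Fin d → ℤ)) (u : (Fin d → ℤ) → ℝ)
    (hu : ∀ x ∉ Y, u x = 0) :
    ∫ k, ‖trig Y (fun x => (u x : ℂ)) k‖ ^ 2 * eps d k ∂(bz d)
      = -∑ x ∈ Y, ∑ p : Fin d × Bool, u x * u (x + dir p) := by
  have hi (z : Fin d → ℤ) : Integrable (chr z) (bz d) := integrable_bz (continuous_chr z)
  have hexp (k : Fin d → ℝ) : ((‖trig Y (fun x => (u x : ℂ)) k‖ ^ 2 * eps d k : ℝ) : ℂ)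
      = -∑ x ∈ Y, ∑ p : Fin d × Bool, ∑ y ∈ Y, ((u x * u y : ℝ) : ℂ) * chr (x - y + dir p) k := by
    rw [Complex.ofReal_mul, sq_norm_trig, eps_eq_sum, mul_neg, Finset.sum_mul]
    congr 1
    refine Finset.sum_congr rfl fun x _ => ?_
    rw [Finset.sum_mul_sum, Finset.sum_comm]
    refine Finset.sum_congr rfl fun p _ => Finset.sum_congr rfl fun y _ => ?_
    rw [chr_add, Complex.conj_ofReal]
    push_cast
    ring
  apply Complex.ofReal_injective
  rw [← integral_complex_ofReal]
  simp only [hexp]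
  rw [integral_neg, integral_finsetSum _ fun x _ => integrable_finsetSum _ fun p _ =>
    integrable_finsetSum _ fun y _ => (hi _).const_mul _]
  push_cast
  congr 1
  refine Finset.sum_congr rfl fun x _ => ?_
  rw [integral_finsetSum _ fun p _ => integrable_finsetSum _ fun y _ => (hi _).const_mul _]
  refine Finset.sum_congr rfl fun p _ => ?_
  rw [integral_finsetSum _ fun y _ => (hi _).const_mul _]
  have h (y : Fin d → ℤ) : x - y + dir p = 0 ↔ x + dir p = y := by
    rw [sub_add_eq_add_sub, sub_eq_zero]
  simp only [integral_const_mul, integral_chr, h, mul_ite, mul_one, mul_zero, Finset.sum_ite_eq]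
  split_ifs with hy
  · rfl
  · rw [hu _ hy]; simp

/-- Bessel's inequality for the indicator function of `S`. -/
lemma sum_sq_norm_fc_le {S : Set (Fin d → ℝ)} (Y : Finset (Fin d → ℤ)) :
    ∑ y ∈ Y, ‖fc S y‖ ^ 2 ≤ (bz d).real S := by
  set a : (Fin d → ℤ) → ℂ := fun y => (starRingEnd ℂ) (fc S y) with ha
  have hc := continuous_trig Y a
  have hi1 : IntegrableOn (fun k => (trig Y a k).re) S (bz d) :=
    (integrable_bz (Complex.continuous_re.comp hc)).integrableOn
  have hre : ∫ k in S, (trig Y a k).re ∂(bz d) = ∑ y ∈ Y, ‖fc S y‖ ^ 2 := by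
    have h1 := integral_re (𝕜 := ℂ) (integrable_bz hc).integrableOn (μ := (bz d).restrict S)
    have h2 : ∫ k in S, trig Y a k ∂(bz d) = ((∑ y ∈ Y, ‖fc S y‖ ^ 2 : ℝ) : ℂ) := by
      simp only [trig]
      rw [integral_finsetSum _ fun y _ =>
        ((integrable_bz (continuous_chr y)).integrableOn).const_mul _]
      push_cast
      refine Finset.sum_congr rfl fun y _ => ?_
      rw [integral_const_mul, ← Complex.conj_mul']
      rfl
    rw [h2] at h1
    exact h1.trans (Complex.ofReal_re _)
  have hle := setIntegral_sq_norm_trig_le S Y a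
  have hnn : 0 ≤ ∫ k in S, (1 - 2 * (trig Y a k).re + ‖trig Y a k‖ ^ 2) ∂(bz d) := by
    refine integral_nonneg fun k => ?_
    have : (trig Y a k).re ^ 2 ≤ ‖trig Y a k‖ ^ 2 :=
      sq_le_sq.mpr (by simpa using Complex.abs_re_le_norm (trig Y a k))
    simp only [Pi.zero_apply]
    nlinarith [sq_nonneg ((trig Y a k).re - 1)]
  rw [integral_add (f := fun k => 1 - 2 * (trig Y a k).re) ((integrable_const _).sub (hi1.const_mul 2))
    (integrable_sq_norm_trig Y a).integrableOn, integral_sub (integrable_const _)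
    (hi1.const_mul 2), integral_const_mul, hre] at hnn
  simp only [ha, RCLike.norm_conj] at hle
  simp only [integral_const, smul_eq_mul, mul_one, measureReal_restrict_apply_univ] at hnn
  linarith

end TrigPolynomials

section Correlations

variable {d : ℕ}

lemma setIntegral_le_add_of_subset_union {α : Type*} [MeasurableSpace α] {m : Measure α}
    {f : α → ℝ} (hf : Integrable f m) (h0 : ∀ x, 0 ≤ f x) {s t u : Set α}
    (hu : MeasurableSet u) (ht : MeasurableSet t) (h : s ⊆ t ∪ u) :
    ∫ x in s, f x ∂m ≤ ∫ x in t, f x ∂m + ∫ x in u, f x ∂m := by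
  have h0' (v : Set α) : 0 ≤ᵐ[m.restrict v] f := Filter.Eventually.of_forall h0
  calc ∫ x in s, f x ∂m ≤ ∫ x in t ∪ (u \ t), f x ∂m :=
        setIntegral_mono_set hf.integrableOn (h0' _)
          (h.trans Set.union_sdiff_self.symm.subset).eventuallyLE
    _ = ∫ x in t, f x ∂m + ∫ x in u \ t, f x ∂m :=
        setIntegral_union Set.disjoint_sdiff_right (hu.diff ht) hf.integrableOn hf.integrableOn
    _ ≤ _ := by
        gcongr
        · exact h0' _
        · exact hf.integrableOn
        · exact Set.sdiff_subset

variable (Y : Finset (Fin d → ℤ)) (g : (Fin d → ℤ) → ℝ)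

/-- The structure factor `|ĝ(k - l)|²` of `g`. -/
noncomputable def sfac (q : (Fin d → ℝ) × (Fin d → ℝ)) : ℝ :=
  ‖trig Y (fun x => (g x : ℂ)) (q.1 - q.2)‖ ^ 2

lemma sfac_nonneg (q : (Fin d → ℝ) × (Fin d → ℝ)) : 0 ≤ sfac Y g q := by
  unfold sfac; positivity

lemma continuous_sfac : Continuous (sfac Y g) :=
  ((continuous_trig Y _).comp (continuous_fst.sub continuous_snd)).norm.pow 2

lemma sfac_swap (k l : Fin d → ℝ) : sfac Y g (k, l) = sfac Y g (l, k) := by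
  have : trig Y (fun x => (g x : ℂ)) (l - k)
      = (starRingEnd ℂ) (trig Y (fun x => (g x : ℂ)) (k - l)) := by
    simp only [trig, map_sum, map_mul, chr_sub_right, Complex.conj_ofReal, Complex.conj_conj]
    exact Finset.sum_congr rfl fun x _ => by ring
  simp only [sfac, this, RCLike.norm_conj]

lemma integral_sfac (l : Fin d → ℝ) :
    ∫ k, sfac Y g (k, l) ∂(bz d) = ∑ x ∈ Y, g x ^ 2 := by
  have h (k : Fin d → ℝ) : sfac Y g (k, l)
      = ‖trig Y (fun x => (g x : ℂ) * (starRingEnd ℂ) (chr x l)) k‖ ^ 2 := by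
    simp only [sfac, trig, chr_sub_right]
    congr 3
    exact funext fun x => by ring
  simp only [h, integral_sq_norm_trig]
  simp [norm_chr]

lemma setIntegral_sfac_univ_prod (S : Set (Fin d → ℝ)) :
    ∫ q in Set.univ ×ˢ S, sfac Y g q ∂((bz d).prod (bz d))
      = (bz d).real S * ∑ x ∈ Y, g x ^ 2 := by
  rw [← Measure.prod_restrict, Measure.restrict_univ, integral_prod_symm]
  · simp only [integral_sfac]
    simp
  · have := (integrable_bz_prod (continuous_sfac Y g)).integrableOn (s := Set.univ ×ˢ S)
    rwa [IntegrableOn, ← Measure.prod_restrict, Measure.restrict_univ] at this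

lemma setIntegral_sfac_prod_univ (S : Set (Fin d → ℝ)) :
    ∫ q in S ×ˢ Set.univ, sfac Y g q ∂((bz d).prod (bz d))
      = (bz d).real S * ∑ x ∈ Y, g x ^ 2 := by
  rw [← Measure.prod_restrict, Measure.restrict_univ, integral_prod]
  · have h (k : Fin d → ℝ) : ∫ l, sfac Y g (k, l) ∂(bz d) = ∑ x ∈ Y, g x ^ 2 := by
      rw [← integral_sfac Y g k]
      exact integral_congr_ae (Filter.Eventually.of_forall fun l => sfac_swap Y g k l)
    simp [h]
  · have := (integrable_bz_prod (continuous_sfac Y g)).integrableOn (s := S ×ˢ Set.univ)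
    rwa [IntegrableOn, ← Measure.prod_restrict, Measure.restrict_univ] at this

lemma setIntegral_sfac_prod_self (S : Set (Fin d → ℝ)) :
    ∫ q in S ×ˢ S, sfac Y g q ∂((bz d).prod (bz d))
      = ∑ x ∈ Y, ∑ y ∈ Y, g x * g y * ‖fc S (x - y)‖ ^ 2 := by
  have hi (z : Fin d → ℤ) : IntegrableOn (chr z) S (bz d) :=
    (integrable_bz (continuous_chr z)).integrableOn
  have hi2 (z : Fin d → ℤ) : Integrable (fun q : (Fin d → ℝ) × (Fin d → ℝ) =>
      chr z q.1 * (starRingEnd ℂ) (chr z q.2)) (((bz d).restrict S).prod ((bz d).restrict S)) := by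
    refine Integrable.mul_prod (hi z) (g := fun l => (starRingEnd ℂ) (chr z l)) ?_
    exact (integrable_bz (Complex.continuous_conj.comp (continuous_chr z))).integrableOn
  rw [← Measure.prod_restrict]
  apply Complex.ofReal_injective
  rw [← integral_complex_ofReal]
  simp only [sfac, sq_norm_trig, chr_sub_right]
  rw [integral_finsetSum _ fun x _ => integrable_finsetSum _ fun y _ => (hi2 _).const_mul _]
  push_cast
  refine Finset.sum_congr rfl fun x _ => ?_
  rw [integral_finsetSum _ fun y _ => (hi2 _).const_mul _]
  refine Finset.sum_congr rfl fun y _ => ?_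
  rw [integral_const_mul, integral_prod_mul (f := chr (x - y))
    (g := fun l => (starRingEnd ℂ) (chr (x - y) l)), integral_conj, Complex.conj_ofReal,
    ← Complex.mul_conj']
  rfl

/-- Particle-hole correlations across `S` control the variation of `g`. -/
lemma sum_sq_sub_le_setIntegral_sfac {S : Set (Fin d → ℝ)} (hS : MeasurableSet S) :
    (∑ x ∈ Y, ∑ y ∈ Y, (g x - g y) ^ 2 * ‖fc S (x - y)‖ ^ 2) / 2
      ≤ ∫ q in S ×ˢ Sᶜ, sfac Y g q ∂((bz d).prod (bz d)) := by
  have hint := integrable_bz_prod (continuous_sfac Y g)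
  have hsplit : ∫ q in S ×ˢ S, sfac Y g q ∂((bz d).prod (bz d))
      + ∫ q in S ×ˢ Sᶜ, sfac Y g q ∂((bz d).prod (bz d)) = (bz d).real S * ∑ x ∈ Y, g x ^ 2 := by
    rw [← setIntegral_sfac_prod_univ,
      ← setIntegral_union _ (hS.prod hS.compl) hint.integrableOn hint.integrableOn,
      ← Set.prod_union, Set.union_compl_self]
    exact Set.disjoint_prod.mpr (Or.inr disjoint_compl_right)
  rw [setIntegral_sfac_prod_self] at hsplit
  have hneg (z : Fin d → ℤ) : ‖fc S (-z)‖ = ‖fc S z‖ := by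
    simp only [fc, ← conj_chr]
    rw [integral_conj, RCLike.norm_conj]
  have hx : ∑ x ∈ Y, ∑ y ∈ Y, g x ^ 2 * ‖fc S (x - y)‖ ^ 2
      ≤ (bz d).real S * ∑ x ∈ Y, g x ^ 2 := by
    rw [Finset.mul_sum]
    refine Finset.sum_le_sum fun x _ => ?_
    rw [← Finset.mul_sum, mul_comm]
    gcongr
    rw [← Finset.sum_image (f := fun z => ‖fc S z‖ ^ 2) (g := fun y => x - y)
      (fun a _ b _ h => sub_right_injective h)]
    exact sum_sq_norm_fc_le _
  have hy : ∑ x ∈ Y, ∑ y ∈ Y, g y ^ 2 * ‖fc S (x - y)‖ ^ 2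
      = ∑ x ∈ Y, ∑ y ∈ Y, g x ^ 2 * ‖fc S (x - y)‖ ^ 2 := by
    rw [Finset.sum_comm]
    refine Finset.sum_congr rfl fun x _ => Finset.sum_congr rfl fun y _ => ?_
    rw [← hneg, neg_sub]
  have hsq : ∑ x ∈ Y, ∑ y ∈ Y, (g x - g y) ^ 2 * ‖fc S (x - y)‖ ^ 2
      = ∑ x ∈ Y, ∑ y ∈ Y, g x ^ 2 * ‖fc S (x - y)‖ ^ 2
        + ∑ x ∈ Y, ∑ y ∈ Y, g y ^ 2 * ‖fc S (x - y)‖ ^ 2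
        - 2 * ∑ x ∈ Y, ∑ y ∈ Y, g x * g y * ‖fc S (x - y)‖ ^ 2 := by
    simp only [Finset.mul_sum, ← Finset.sum_add_distrib, ← Finset.sum_sub_distrib]
    exact Finset.sum_congr rfl fun x _ => Finset.sum_congr rfl fun y _ => by ring
  linarith

end Correlations

section Boundary

variable {d : ℕ}

lemma dir_injective : Function.Injective (dir (d := d)) := by
  rintro ⟨i, a⟩ ⟨j, b⟩ h
  have hi := congrFun h i
  have hj := congrFun h j
  rcases eq_or_ne i j with rfl | hij
  · cases a <;> cases b <;> simp_all [dir]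
  · cases a <;> cases b <;> simp_all [dir]

lemma dist1_eq_one_iff (x y : Fin d → ℤ) : dist1 x y = 1 ↔ ∃ p, y = x + dir p := by
  constructor
  · intro h
    rw [dist1] at h
    obtain ⟨i, -, hi⟩ := Finset.exists_ne_zero_of_sum_ne_zero (h.trans_ne one_ne_zero)
    rw [← Finset.add_sum_erase _ _ (Finset.mem_univ i)] at h
    have h0 : ∑ j ∈ Finset.univ.erase i, (x j - y j).natAbs = 0 := by omega
    rw [Finset.sum_eq_zero_iff] at h0
    have hj (j : Fin d) (hj : j ≠ i) : y j = x j := by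
      have := h0 j (Finset.mem_erase.mpr ⟨hj, Finset.mem_univ j⟩)
      omega
    have hyi : y i = x i + 1 ∨ y i = x i - 1 := by omega
    rcases hyi with hyi | hyi
    · refine ⟨(i, true), funext fun j => ?_⟩
      rcases eq_or_ne j i with rfl | hji
      · simp [dir, hyi]
      · simp [dir, hji, hj j hji]
    · refine ⟨(i, false), funext fun j => ?_⟩
      rcases eq_or_ne j i with rfl | hji
      · simp [dir, hyi, sub_eq_add_neg]
      · simp [dir, hji, hj j hji]
  · rintro ⟨p, rfl⟩
    rw [dist1, Finset.sum_eq_single p.1]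
    · rcases p with ⟨i, _ | _⟩ <;> simp [dir]
    · intro b _ hb
      simp [dir, hb]
    · simp

/-- The boundary counted direction by direction. -/
lemma bdry_eq_sum (A : Finset (Fin d → ℤ)) :
    bdry (A : Set (Fin d → ℤ))
      = ∑ p : Fin d × Bool, (A.filter fun x => x + dir p ∉ A).card := by
  have h : {q : (Fin d → ℤ) × (Fin d → ℤ) |
      q.1 ∈ (A : Set (Fin d → ℤ)) ∧ q.2 ∉ (A : Set (Fin d → ℤ)) ∧ dist1 q.1 q.2 = 1}
      = ((Finset.univ.sigma fun p : Fin d × Bool => A.filter fun x => x + dir p ∉ A).image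
          fun s => (s.2, s.2 + dir s.1) : Finset _) := by
    ext ⟨x, y⟩
    simp only [Set.mem_ofPred_eq, Finset.coe_image, Set.mem_image, Finset.mem_coe,
      Finset.mem_sigma, Finset.mem_filter, Finset.mem_univ, true_and, dist1_eq_one_iff]
    constructor
    · rintro ⟨hx, hy, p, rfl⟩
      exact ⟨⟨p, x⟩, ⟨hx, hy⟩, rfl⟩
    · rintro ⟨⟨p, z⟩, ⟨hz, hz'⟩, heq⟩
      simp only [Prod.mk.injEq] at heq
      obtain ⟨rfl, rfl⟩ := heq
      exact ⟨hz, hz', p, rfl⟩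
  rw [bdry, h, Set.ncard_coe_finset, Finset.card_image_of_injective, Finset.card_sigma]
  rintro ⟨p, x⟩ ⟨q, y⟩ hxy
  simp only [Prod.mk.injEq] at hxy
  obtain ⟨rfl, h2⟩ := hxy
  rw [dir_injective (add_left_cancel h2)]

/-- The indicator function of `A`. -/
noncomputable def ind (A : Finset (Fin d → ℤ)) (x : Fin d → ℤ) : ℝ := if x ∈ A then 1 else 0

/-- A window large enough to contain all second differences of the indicator of `A`. -/
noncomputable def window (A : Finset (Fin d → ℤ)) (p : Fin d × Bool) : Finset (Fin d → ℤ) :=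
  A ∪ A.image (· + dir p) ∪ A.image (· - dir p)

/-- The discrete derivative of the indicator function of `A`. -/
noncomputable def dind (A : Finset (Fin d → ℤ)) (p : Fin d × Bool) (x : Fin d → ℤ) : ℝ :=
  ind A (x + dir p) - ind A x

lemma trig_dind (A : Finset (Fin d → ℤ)) (p : Fin d × Bool) (k : Fin d → ℝ) :
    trig (window A p) (fun x => (dind A p x : ℂ)) k
      = ((starRingEnd ℂ) (chr (dir p) k) - 1) * trig A 1 k := by
  have h1 : ∑ x ∈ window A p, (ind A x : ℂ) * chr x k = trig A 1 k := by
    refine (Finset.sum_subset ?_ ?_).symm.trans (Finset.sum_congr rfl fun x hx => ?_)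
    · intro x hx
      simp [window, hx]
    · intro x _ hx
      simp [ind, hx]
    · simp [ind, hx]
  have h2 : ∑ x ∈ window A p, (ind A (x + dir p) : ℂ) * chr x k
      = (starRingEnd ℂ) (chr (dir p) k) * trig A 1 k := by
    refine (Finset.sum_subset (s₁ := A.image (· - dir p)) ?_ ?_).symm.trans ?_
    · intro x hx
      simp only [window, Finset.mem_union]
      exact Or.inr hx
    · intro x _ hx
      have : x + dir p ∉ A := fun h => hx (Finset.mem_image.mpr ⟨_, h, by simp⟩)
      simp [ind, this]
    · rw [Finset.sum_image fun a _ b _ h => sub_left_injective h, trig, Finset.mul_sum]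
      refine Finset.sum_congr rfl fun x hx => ?_
      simp only [sub_add_cancel, ind, hx, if_true, chr_sub, Pi.one_apply]
      push_cast
      ring
  rw [sub_mul, one_mul, ← h2, ← h1, trig, ← Finset.sum_sub_distrib]
  refine Finset.sum_congr rfl fun x _ => ?_
  rw [dind]
  push_cast
  ring

lemma sfac_dind_le (A : Finset (Fin d → ℤ)) (p : Fin d × Bool)
    (q : (Fin d → ℝ) × (Fin d → ℝ)) :
    sfac (window A p) (dind A p) q ≤ 4 * ‖trig A 1 (q.1 - q.2)‖ ^ 2 := by
  rw [sfac, trig_dind, norm_mul, mul_pow]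
  gcongr
  have : ‖(starRingEnd ℂ) (chr (dir p) (q.1 - q.2)) - 1‖ ≤ 2 := by
    refine (norm_sub_le _ _).trans ?_
    rw [RCLike.norm_conj, norm_chr, norm_one]
    norm_num
  nlinarith [norm_nonneg ((starRingEnd ℂ) (chr (dir p) (q.1 - q.2)) - 1)]

lemma card_le_sum_sq_dind (A : Finset (Fin d → ℤ)) (p : Fin d × Bool) :
    ((A.filter fun x => x + dir p ∉ A).card : ℝ) ≤ ∑ x ∈ window A p, dind A p x ^ 2 := by
  calc ((A.filter fun x => x + dir p ∉ A).card : ℝ)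
      = ∑ x ∈ A.filter fun x => x + dir p ∉ A, dind A p x ^ 2 := by
        rw [Finset.card_eq_sum_ones, Nat.cast_sum]
        refine Finset.sum_congr rfl fun x hx => ?_
        obtain ⟨hx, hx'⟩ := Finset.mem_filter.mp hx
        simp [dind, ind, hx, hx']
    _ ≤ _ := by
        refine Finset.sum_le_sum_of_subset_of_nonneg (fun x hx => ?_) fun x _ _ => sq_nonneg _
        simp [window, (Finset.mem_filter.mp hx).1]

/-- A step of the indicator function is never continued by an equal step. -/
lemma sum_sq_dind_le (A : Finset (Fin d → ℤ)) (p : Fin d × Bool) :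
    ∑ x ∈ window A p, dind A p x ^ 2
      ≤ ∑ x ∈ window A p, ∑ y ∈ window A p,
          if y = x + dir p then (dind A p x - dind A p y) ^ 2 else 0 := by
  refine Finset.sum_le_sum fun x _ => ?_
  have hnn : ∀ y ∈ window A p,
      0 ≤ if y = x + dir p then (dind A p x - dind A p y) ^ 2 else 0 := fun y _ => by
    split_ifs <;> positivity
  by_cases hx : dind A p x = 0
  · rw [hx]
    simpa [hx] using Finset.sum_nonneg hnn
  · have hmem : x + dir p ∈ window A p := by
      simp only [window, Finset.mem_union, Finset.mem_image]
      by_cases h1 : x ∈ A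
      · exact Or.inl (Or.inr ⟨x, h1, rfl⟩)
      · by_cases h2 : x + dir p ∈ A
        · exact Or.inl (Or.inl h2)
        · simp [dind, ind, h1, h2] at hx
    refine le_trans ?_ (Finset.single_le_sum hnn hmem)
    rw [if_pos rfl]
    simp only [dind, ind] at hx ⊢
    split_ifs at hx ⊢ <;> norm_num at *

/-- Particle-hole correlations across a sublevel set, away from a thin shell around the Fermi
surface, control the boundary of `A` in each direction. -/
lemma boundary_le_setIntegral_sfac (A : Finset (Fin d → ℤ)) (p : Fin d × Bool) (E δ c : ℝ)
    (hδ : 0 ≤ δ) (hc : c ≤ ‖fc {k | eps d k < E} (dir p)‖ ^ 2)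
    (hs : (bz d).real {k | |eps d k - E| ≤ δ} ≤ c / 8) :
    c / 4 * ((A.filter fun x => x + dir p ∉ A).card : ℝ)
      ≤ 4 * ∫ q in {k | eps d k < E - δ} ×ˢ {k | E + δ < eps d k},
          ‖trig A 1 (q.1 - q.2)‖ ^ 2 ∂((bz d).prod (bz d)) := by
  set Y := window A p
  set g := dind A p
  set G := ∑ x ∈ Y, g x ^ 2 with hG
  set H := {k : Fin d → ℝ | |eps d k - E| ≤ δ} with hH
  have hm := measurableSet_sublevel (d := d) E
  have hme := (continuous_eps (d := d)).measurable
  have hmH : MeasurableSet H :=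
    measurableSet_le (continuous_eps.sub continuous_const).abs.measurable measurable_const
  have hm1 : MeasurableSet {k : Fin d → ℝ | eps d k < E - δ} := measurableSet_sublevel _
  have hm2 : MeasurableSet {k : Fin d → ℝ | E + δ < eps d k} :=
    measurableSet_lt measurable_const hme
  have hint := integrable_bz_prod (continuous_sfac Y g)
  have hc0 : 0 ≤ c := by
    have := measureReal_nonneg (μ := bz d) (s := H)
    linarith
  have hG0 : 0 ≤ G := Finset.sum_nonneg fun x _ => sq_nonneg _
  have hlow : c * G / 2 ≤ ∫ q in {k | eps d k < E} ×ˢ {k | eps d k < E}ᶜ,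
      sfac Y g q ∂((bz d).prod (bz d)) := by
    refine le_trans ?_ (sum_sq_sub_le_setIntegral_sfac Y g hm)
    gcongr
    calc c * G ≤ c * ∑ x ∈ Y, ∑ y ∈ Y, if y = x + dir p then (g x - g y) ^ 2 else 0 := by
          gcongr
          exact sum_sq_dind_le A p
      _ ≤ _ := by
          simp only [Finset.mul_sum]
          refine Finset.sum_le_sum fun x _ => Finset.sum_le_sum fun y _ => ?_
          split_ifs with h
          · rw [mul_comm]
            gcongr
            have hneg : ‖fc {k | eps d k < E} (x - y)‖ = ‖fc {k | eps d k < E} (dir p)‖ := by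
              rw [h, sub_add_cancel_left, fc, fc]
              simp only [← conj_chr]
              rw [integral_conj, RCLike.norm_conj]
            rwa [hneg]
          · rw [mul_zero]
            positivity
  have hcover : {k : Fin d → ℝ | eps d k < E} ×ˢ {k : Fin d → ℝ | eps d k < E}ᶜ
      ⊆ {k | eps d k < E - δ} ×ˢ {k | E + δ < eps d k} ∪ (H ×ˢ Set.univ ∪ Set.univ ×ˢ H) := by
    rintro ⟨k, l⟩ ⟨hk, hl⟩
    simp only [Set.mem_ofPred_eq, Set.mem_compl_iff, not_lt] at hk hl
    simp only [Set.mem_union, Set.mem_prod, Set.mem_ofPred_eq, hH, Set.mem_univ, and_true,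
      true_and]
    by_cases h1 : eps d k < E - δ
    · by_cases h2 : E + δ < eps d l
      · exact Or.inl ⟨h1, h2⟩
      · exact Or.inr (Or.inr (abs_le.mpr ⟨by linarith, by linarith⟩))
    · exact Or.inr (Or.inl (abs_le.mpr ⟨by linarith, by linarith⟩))
  have h1 := setIntegral_le_add_of_subset_union hint (sfac_nonneg Y g)
    ((hmH.prod .univ).union (.prod .univ hmH)) (hm1.prod hm2) hcover
  have h2 := setIntegral_le_add_of_subset_union hint (sfac_nonneg Y g)
    (.prod .univ hmH) (hmH.prod .univ) (subset_refl _)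
  rw [setIntegral_sfac_prod_univ, setIntegral_sfac_univ_prod, ← hG] at h2
  have h3 : ∫ q in {k | eps d k < E - δ} ×ˢ {k | E + δ < eps d k},
      sfac Y g q ∂((bz d).prod (bz d))
      ≤ 4 * ∫ q in {k | eps d k < E - δ} ×ˢ {k | E + δ < eps d k},
          ‖trig A 1 (q.1 - q.2)‖ ^ 2 ∂((bz d).prod (bz d)) := by
    rw [← integral_const_mul]
    refine setIntegral_mono hint.integrableOn ?_ (sfac_dind_le A p)
    exact (integrable_bz_prod (((continuous_trig A 1).comp
      (continuous_fst.sub continuous_snd)).norm.pow 2)).integrableOn.const_mul 4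
  have h4 : (bz d).real H * G ≤ c / 8 * G := by gcongr
  have h5 : c / 4 * ((A.filter fun x => x + dir p ∉ A).card : ℝ) ≤ c / 4 * G := by
    gcongr
    exact card_le_sum_sq_dind A p
  linarith

end Boundary

section EigenSystem

variable {d : ℕ}

/-- The adjacency matrix of `ℤ^d`. -/
noncomputable def adj (x y : Fin d → ℤ) : ℝ := if dist1 x y = 1 then 1 else 0

lemma adj_nonneg (x y : Fin d → ℤ) : 0 ≤ adj x y := by
  unfold adj; split_ifs <;> norm_num

lemma dist1_comm (x y : Fin d → ℤ) : dist1 x y = dist1 y x :=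
  Finset.sum_congr rfl fun i _ => by rw [← Int.natAbs_neg, neg_sub]

lemma adj_comm (x y : Fin d → ℤ) : adj x y = adj y x := by rw [adj, adj, dist1_comm]

lemma sum_adj_mul (Y : Finset (Fin d → ℤ)) (x : Fin d → ℤ) (f : (Fin d → ℤ) → ℝ) :
    ∑ y ∈ Y, adj x y * f y
      = ∑ p : Fin d × Bool, if x + dir p ∈ Y then f (x + dir p) else 0 := by
  have h (y : Fin d → ℤ) : adj x y = ∑ p : Fin d × Bool, if x + dir p = y then 1 else 0 := by
    rw [adj]
    split_ifs with hxy
    · obtain ⟨p, rfl⟩ := (dist1_eq_one_iff x y).mp hxy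
      rw [Finset.sum_eq_single p]
      · simp
      · intro q _ hq
        exact if_neg fun hh => hq (dir_injective (add_left_cancel hh))
      · simp
    · refine (Finset.sum_eq_zero fun p _ => if_neg fun hh => hxy ?_).symm
      exact (dist1_eq_one_iff x y).mpr ⟨p, hh.symm⟩
  simp only [h, Finset.sum_mul]
  rw [Finset.sum_comm]
  refine Finset.sum_congr rfl fun p _ => ?_
  simp only [ite_mul, one_mul, zero_mul, Finset.sum_ite_eq]

lemma sum_adj_le (Y : Finset (Fin d → ℤ)) (x : Fin d → ℤ) : ∑ y ∈ Y, adj x y ≤ 2 * d := by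
  have h := sum_adj_mul Y x 1
  simp only [Pi.one_apply, mul_one] at h
  rw [h]
  calc _ ≤ ∑ p : Fin d × Bool, (1 : ℝ) := by
        gcongr
        split_ifs <;> norm_num
    _ = 2 * d := by simp [mul_comm]

lemma bdry_eq_sum_ite (A : Finset (Fin d → ℤ)) :
    (bdry (A : Set (Fin d → ℤ)) : ℝ)
      = ∑ x ∈ A, ∑ p : Fin d × Bool, if x + dir p ∈ A then (0 : ℝ) else 1 := by
  rw [bdry_eq_sum, Finset.sum_comm]
  push_cast
  refine Finset.sum_congr rfl fun p _ => ?_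
  rw [Finset.card_filter]
  push_cast
  exact Finset.sum_congr rfl fun x _ => by split_ifs <;> simp_all

lemma sum_sum_adj (A : Finset (Fin d → ℤ)) :
    ∑ x ∈ A, ∑ y ∈ A, adj x y = 2 * d * A.card - bdry (A : Set (Fin d → ℤ)) := by
  have h (x : Fin d → ℤ) := sum_adj_mul A x 1
  simp only [Pi.one_apply, mul_one] at h
  rw [bdry_eq_sum_ite, eq_sub_iff_add_eq, ← Finset.sum_add_distrib]
  have (x : Fin d → ℤ) : ∑ y ∈ A, adj x y + ∑ p : Fin d × Bool,
      (if x + dir p ∈ A then (0 : ℝ) else 1) = 2 * d := by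
    rw [h, ← Finset.sum_add_distrib, Finset.sum_congr rfl (g := fun _ => (1 : ℝ))]
    · simp [mul_comm]
    · intro p _
      split_ifs <;> norm_num
  simp [this, mul_comm]

lemma sum_sum_adj_sdiff_le (A C : Finset (Fin d → ℤ)) (hC : Disjoint A C) :
    ∑ x ∈ C, ∑ y ∈ A, adj x y ≤ bdry (A : Set (Fin d → ℤ)) := by
  have h (x : Fin d → ℤ) := sum_adj_mul C x 1
  simp only [Pi.one_apply, mul_one] at h
  rw [Finset.sum_comm, bdry_eq_sum_ite]
  refine Finset.sum_le_sum fun y _ => ?_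
  simp only [adj_comm _ y]
  rw [h]
  refine Finset.sum_le_sum fun p _ => ?_
  split_ifs with h1 h2 <;> norm_num
  exact Finset.disjoint_left.mp hC h2 h1

/-- A real orthonormal eigensystem of `h_V`, extended by zero outside `Λ`. -/
structure EigenSystem (Λ : Finset (Fin d → ℤ)) (V : (Fin d → ℤ) → ℝ) where
  /-- The eigenvalues. -/
  ev : Λ → ℝ
  /-- The eigenfunctions. -/
  fn : Λ → (Fin d → ℤ) → ℝ
  orth : ∀ i j, ∑ x ∈ Λ, fn i x * fn j x = if i = j then 1 else 0
  complete : ∀ x ∈ Λ, ∀ y ∈ Λ, ∑ i, fn i x * fn i y = if x = y then 1 else 0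
  eigen : ∀ i, ∀ x ∈ Λ, V x * fn i x - ∑ y ∈ Λ, adj x y * fn i y = ev i * fn i x
  SN_eq : ∀ N, SN d Λ V N
    = sInf ((fun s : Finset Λ => ∑ i ∈ s, ev i) '' {s : Finset Λ | s.card = N})

lemma isHermitian_hV (Λ : Finset (Fin d → ℤ)) (V : (Fin d → ℤ) → ℝ) :
    (hV d Λ V).IsHermitian := by
  ext x y
  simp only [Matrix.conjTranspose_apply, hV, star_trivial, dist1_comm (y : Fin d → ℤ) x]
  by_cases h : (x : Fin d → ℤ) = y
  · rw [h]
  · simp [h, Ne.symm h]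

lemma hV_apply (Λ : Finset (Fin d → ℤ)) (V : (Fin d → ℤ) → ℝ) (x y : Λ) :
    hV d Λ V x y = (if y = x then V x else 0) - adj (x : Fin d → ℤ) y := by
  by_cases h : y = x
  · subst h
    simp [hV, adj, dist1]
  · have h' : (x : Fin d → ℤ) ≠ y := fun hh => h (Subtype.ext hh.symm)
    simp only [hV, adj, h, h', if_false]
    split_ifs <;> norm_num

lemma exists_eigenSystem (Λ : Finset (Fin d → ℤ)) (V : (Fin d → ℤ) → ℝ) :
    Nonempty (EigenSystem Λ V) := by
  have hh := isHermitian_hV Λ V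
  let b := hh.eigenvectorBasis
  let f : Λ → (Fin d → ℤ) → ℝ := fun i x => if h : x ∈ Λ then b i ⟨x, h⟩ else 0
  have hf (i x : Λ) : f i x = b i x := by simp [f]
  refine ⟨⟨hh.eigenvalues, f, fun i j => ?_, fun x hx y hy => ?_, fun i x hx => ?_, fun N => ?_⟩⟩
  · rw [← Finset.sum_coe_sort Λ fun x => f i x * f j x]
    simp only [hf]
    have := b.inner_eq_ite j i
    simp only [PiLp.inner_apply, eq_comm (a := j)] at this
    simpa using this
  · have h := b.sum_inner_mul_inner (EuclideanSpace.single ⟨x, hx⟩ 1)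
      (EuclideanSpace.single ⟨y, hy⟩ 1)
    have hx' (i : Λ) : f i x = b i ⟨x, hx⟩ := hf i ⟨x, hx⟩
    have hy' (i : Λ) : f i y = b i ⟨y, hy⟩ := hf i ⟨y, hy⟩
    simp only [hx', hy']
    simp only [eq_comm (a := x)]
    simpa [EuclideanSpace.inner_single_left, EuclideanSpace.inner_single_right] using h
  · have h := congrFun (hh.mulVec_eigenvectorBasis i) ⟨x, hx⟩
    have hx' : f i x = b i ⟨x, hx⟩ := hf i ⟨x, hx⟩
    rw [← Finset.sum_coe_sort Λ fun y => adj x y * f i y]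
    simp only [hf, hx']
    simp only [Matrix.mulVec, dotProduct, hV_apply, sub_mul, ite_mul, zero_mul,
      Finset.sum_sub_distrib, Finset.sum_ite_eq', Finset.mem_univ, if_true, Pi.smul_apply,
      smul_eq_mul] at h
    exact h
  · rw [SN, sumSmallest, dif_pos hh]

lemma nonempty_card_eq {ι : Type*} [Fintype ι] {N : ℕ} (hN : N ≤ Fintype.card ι) :
    {s : Finset ι | s.card = N}.Nonempty := by
  obtain ⟨s, -, hs⟩ := Finset.exists_subset_card_eq (s := (Finset.univ : Finset ι)) hN
  exact ⟨s, hs⟩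

variable {Λ : Finset (Fin d → ℤ)} {V : (Fin d → ℤ) → ℝ}

lemma EigenSystem.SN_le (B : EigenSystem Λ V) (s : Finset Λ) :
    SN d Λ V s.card ≤ ∑ i ∈ s, B.ev i := by
  rw [B.SN_eq]
  exact csInf_le (Set.toFinite _).bddBelow ⟨s, rfl, rfl⟩

lemma EigenSystem.le_SN (B : EigenSystem Λ V) {N : ℕ} (hN : N ≤ Λ.card) {r : ℝ}
    (h : ∀ s : Finset Λ, s.card = N → r ≤ ∑ i ∈ s, B.ev i) : r ≤ SN d Λ V N := by
  rw [B.SN_eq]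
  refine le_csInf ((nonempty_card_eq (by simpa using hN)).image _) ?_
  rintro _ ⟨s, hs, rfl⟩
  exact h s hs

/-- The Fourier transform of the restriction of an eigenfunction to `A`. -/
noncomputable def EigenSystem.ft (B : EigenSystem Λ V) (A : Finset (Fin d → ℤ)) (i : Λ)
    (k : Fin d → ℝ) : ℂ := trig A (fun x => (B.fn i x : ℂ)) k

/-- The momentum distribution in `A` of the eigenfunctions with labels in `s`. -/
noncomputable def EigenSystem.occ (B : EigenSystem Λ V) (A : Finset (Fin d → ℤ)) (s : Finset Λ)
    (k : Fin d → ℝ) : ℝ := ∑ i ∈ s, ‖B.ft A i k‖ ^ 2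

variable (B : EigenSystem Λ V) {A : Finset (Fin d → ℤ)}

lemma EigenSystem.continuous_ft (i : Λ) : Continuous (B.ft A i) := continuous_trig _ _

lemma EigenSystem.continuous_occ (s : Finset Λ) : Continuous (B.occ A s) :=
  continuous_finsetSum _ fun i _ => (B.continuous_ft i).norm.pow 2

lemma EigenSystem.occ_nonneg (s : Finset Λ) (k : Fin d → ℝ) : 0 ≤ B.occ A s k :=
  Finset.sum_nonneg fun i _ => by positivity

lemma EigenSystem.sum_ft_mul_conj (hA : A ⊆ Λ) (k l : Fin d → ℝ) :
    ∑ i, B.ft A i k * (starRingEnd ℂ) (B.ft A i l) = trig A 1 (k - l) := by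
  have hc (x y : Fin d → ℤ) (hx : x ∈ A) (hy : y ∈ A) :
      ∑ i, (B.fn i x : ℂ) * B.fn i y = if x = y then 1 else 0 := by
    have := congrArg ((↑) : ℝ → ℂ) (B.complete x (hA hx) y (hA hy))
    push_cast at this
    rw [this]
    split_ifs <;> simp
  calc ∑ i, B.ft A i k * (starRingEnd ℂ) (B.ft A i l)
      = ∑ i, ∑ x ∈ A, ∑ y ∈ A, (B.fn i x : ℂ) * B.fn i y
          * (chr x k * (starRingEnd ℂ) (chr y l)) := by
        refine Finset.sum_congr rfl fun i _ => ?_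
        rw [EigenSystem.ft, EigenSystem.ft, trig, trig, map_sum, Finset.sum_mul_sum]
        refine Finset.sum_congr rfl fun x _ => Finset.sum_congr rfl fun y _ => ?_
        rw [map_mul, Complex.conj_ofReal]
        ring
    _ = ∑ x ∈ A, ∑ y ∈ A, (if x = y then 1 else 0) * (chr x k * (starRingEnd ℂ) (chr y l)) := by
        rw [Finset.sum_comm]
        refine Finset.sum_congr rfl fun x hx => ?_
        rw [Finset.sum_comm]
        refine Finset.sum_congr rfl fun y hy => ?_
        rw [← Finset.sum_mul, hc x y hx hy]
    _ = _ := by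
        refine Finset.sum_congr rfl fun x hx => ?_
        simp [hx, chr_sub_right]

lemma EigenSystem.occ_add_occ_compl (hA : A ⊆ Λ) (s : Finset Λ) (k : Fin d → ℝ) :
    B.occ A s k + B.occ A sᶜ k = A.card := by
  rw [EigenSystem.occ, EigenSystem.occ, Finset.sum_add_sum_compl]
  have h := B.sum_ft_mul_conj hA k k
  simp only [Complex.mul_conj'] at h
  have h2 : trig A 1 (k - k) = A.card := by simp [trig, chr]
  rw [h2] at h
  exact_mod_cast h

lemma EigenSystem.setIntegral_sq_norm_sum_ft_le (hA : A ⊆ Λ) (s : Finset Λ)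
    (S : Set (Fin d → ℝ)) (w : Λ → ℂ) :
    ∫ k in S, ‖∑ i ∈ s, B.ft A i k * w i‖ ^ 2 ∂(bz d) ≤ ∑ i ∈ s, ‖w i‖ ^ 2 := by
  have h1 (k : Fin d → ℝ) : ∑ i ∈ s, B.ft A i k * w i
      = trig A (fun x => ∑ i ∈ s, (B.fn i x : ℂ) * w i) k := by
    simp only [EigenSystem.ft, trig, Finset.sum_mul]
    rw [Finset.sum_comm]
    exact Finset.sum_congr rfl fun x _ => Finset.sum_congr rfl fun i _ => by ring
  simp only [h1]
  refine (setIntegral_sq_norm_trig_le S A _).trans ?_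
  refine (Finset.sum_le_sum_of_subset_of_nonneg hA fun x _ _ => by positivity).trans
    (le_of_eq ?_)
  apply Complex.ofReal_injective
  push_cast
  simp only [← Complex.mul_conj', map_sum, map_mul, Complex.conj_ofReal, Finset.sum_mul_sum]
  rw [Finset.sum_comm]
  refine Finset.sum_congr rfl fun i hi => ?_
  rw [Finset.sum_comm, Finset.sum_eq_single_of_mem i hi]
  · have := congrArg ((↑) : ℝ → ℂ) (B.orth i i)
    push_cast at this
    calc _ = (∑ x ∈ Λ, (B.fn i x : ℂ) * B.fn i x) * (w i * (starRingEnd ℂ) (w i)) := by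
          rw [Finset.sum_mul]
          exact Finset.sum_congr rfl fun x _ => by ring
      _ = _ := by rw [this]; simp
  · intro j _ hj
    have := congrArg ((↑) : ℝ → ℂ) (B.orth i j)
    push_cast at this
    calc _ = (∑ x ∈ Λ, (B.fn i x : ℂ) * B.fn j x) * (w i * (starRingEnd ℂ) (w j)) := by
          rw [Finset.sum_mul]
          exact Finset.sum_congr rfl fun x _ => by ring
      _ = _ := by rw [this]; simp [hj.symm]

end EigenSystem

section LowerBound

variable {d : ℕ} {Λ : Finset (Fin d → ℤ)} {V : (Fin d → ℤ) → ℝ} (B : EigenSystem Λ V)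
  {A : Finset (Fin d → ℤ)}

lemma EigenSystem.setIntegral_sq_norm_trig_sub_le (hA : A ⊆ Λ) (s : Finset Λ)
    (S T : Set (Fin d → ℝ)) :
    ∫ q in S ×ˢ T, ‖trig A 1 (q.1 - q.2)‖ ^ 2 ∂((bz d).prod (bz d))
      ≤ 2 * ∫ k in T, B.occ A s k ∂(bz d) + 2 * ∫ k in S, B.occ A sᶜ k ∂(bz d) := by
  let F (t : Finset Λ) (q : (Fin d → ℝ) × (Fin d → ℝ)) : ℝ :=
    ‖∑ i ∈ t, B.ft A i q.1 * (starRingEnd ℂ) (B.ft A i q.2)‖ ^ 2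
  have hFc (t : Finset Λ) : Continuous (F t) :=
    (continuous_finsetSum _ fun i _ => ((B.continuous_ft i).comp continuous_fst).mul
      (Complex.continuous_conj.comp ((B.continuous_ft i).comp continuous_snd))).norm.pow 2
  have hFi (t : Finset Λ) : IntegrableOn (F t) (S ×ˢ T) ((bz d).prod (bz d)) :=
    (integrable_bz_prod (hFc t)).integrableOn
  have hFi' (t : Finset Λ) :
      Integrable (F t) (((bz d).restrict S).prod ((bz d).restrict T)) := by
    have := hFi t
    rwa [IntegrableOn, ← Measure.prod_restrict] at this
  have hswap (t : Finset Λ) (k l : Fin d → ℝ) : F t (k, l) = F t (l, k) := by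
    simp only [F]
    rw [← RCLike.norm_conj, map_sum]
    congr 2
    refine Finset.sum_congr rfl fun i _ => ?_
    rw [map_mul, Complex.conj_conj, mul_comm]
  have hle (t : Finset Λ) (R : Set (Fin d → ℝ)) (l : Fin d → ℝ) :
      ∫ k in R, F t (k, l) ∂(bz d) ≤ B.occ A t l := by
    have := B.setIntegral_sq_norm_sum_ft_le hA t R fun i => (starRingEnd ℂ) (B.ft A i l)
    simp only [RCLike.norm_conj] at this
    exact this
  have hocc (t : Finset Λ) (R : Set (Fin d → ℝ)) : Integrable (B.occ A t) ((bz d).restrict R) :=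
    (integrable_bz (B.continuous_occ t)).integrableOn
  have h1 : ∫ q in S ×ˢ T, F s q ∂((bz d).prod (bz d)) ≤ ∫ k in T, B.occ A s k ∂(bz d) := by
    rw [← Measure.prod_restrict, integral_prod_symm _ (hFi' s)]
    exact integral_mono (hFi' s).integral_prod_right (hocc s T) fun l => hle s S l
  have h2 : ∫ q in S ×ˢ T, F sᶜ q ∂((bz d).prod (bz d)) ≤ ∫ k in S, B.occ A sᶜ k ∂(bz d) := by
    rw [← Measure.prod_restrict, integral_prod _ (hFi' sᶜ)]
    refine integral_mono (hFi' sᶜ).integral_prod_left (hocc sᶜ S) fun k => ?_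
    simp only [hswap sᶜ k]
    exact hle sᶜ T k
  have hpt (q : (Fin d → ℝ) × (Fin d → ℝ)) :
      ‖trig A 1 (q.1 - q.2)‖ ^ 2 ≤ 2 * F s q + 2 * F sᶜ q := by
    rw [← B.sum_ft_mul_conj hA, ← Finset.sum_add_sum_compl s]
    simp only [F]
    set a := ∑ i ∈ s, B.ft A i q.1 * (starRingEnd ℂ) (B.ft A i q.2)
    set b := ∑ i ∈ sᶜ, B.ft A i q.1 * (starRingEnd ℂ) (B.ft A i q.2)
    nlinarith [norm_add_le a b, norm_nonneg (a + b), sq_nonneg (‖a‖ - ‖b‖)]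
  have htrig : IntegrableOn (fun q : (Fin d → ℝ) × (Fin d → ℝ) => ‖trig A 1 (q.1 - q.2)‖ ^ 2)
      (S ×ˢ T) ((bz d).prod (bz d)) :=
    (integrable_bz_prod
      (((continuous_trig A 1).comp (continuous_fst.sub continuous_snd)).norm.pow 2)).integrableOn
  calc _ ≤ ∫ q in S ×ˢ T, (2 * F s q + 2 * F sᶜ q) ∂((bz d).prod (bz d)) :=
        integral_mono htrig (((hFi s).const_mul 2).add ((hFi sᶜ).const_mul 2)) hpt
    _ = 2 * ∫ q in S ×ˢ T, F s q ∂((bz d).prod (bz d))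
          + 2 * ∫ q in S ×ˢ T, F sᶜ q ∂((bz d).prod (bz d)) := by
        rw [integral_add ((hFi s).const_mul 2) ((hFi sᶜ).const_mul 2), integral_const_mul,
          integral_const_mul]
    _ ≤ _ := by gcongr

lemma EigenSystem.integrable_occ_mul_eps_sub (s : Finset Λ) (μ : ℝ) :
    Integrable (fun k => B.occ A s k * (eps d k - μ)) (bz d) :=
  integrable_bz ((B.continuous_occ s).mul (continuous_eps.sub continuous_const))

lemma mul_Rfun_sub_en (μ : ℝ) :
    μ * Rfun d μ - en d μ = ∫ k in {k | eps d k < μ}, (μ - eps d k) ∂(bz d) := by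
  rw [Rfun_eq, en_eq, integral_sub (integrable_const _)
    (integrable_bz continuous_eps).integrableOn, setIntegral_const, smul_eq_mul, mul_comm]

lemma EigenSystem.mul_setIntegral_occ_le (hA : A ⊆ Λ) (s : Finset Λ) (μ : ℝ) {δ : ℝ}
    (hδ : 0 ≤ δ) :
    δ * (∫ k in {k | μ + δ < eps d k}, B.occ A s k ∂(bz d)
        + ∫ k in {k | eps d k < μ - δ}, B.occ A sᶜ k ∂(bz d))
      ≤ ∫ k, B.occ A s k * (eps d k - μ) ∂(bz d) + A.card * (μ * Rfun d μ - en d μ) := by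
  have hm1 : MeasurableSet {k : Fin d → ℝ | eps d k < μ - δ} :=
    measurableSet_lt continuous_eps.measurable measurable_const
  have hm2 : MeasurableSet {k : Fin d → ℝ | μ + δ < eps d k} :=
    measurableSet_lt measurable_const continuous_eps.measurable
  have hm3 : MeasurableSet {k : Fin d → ℝ | eps d k < μ} :=
    measurableSet_lt continuous_eps.measurable measurable_const
  have hi1 := (integrable_bz (B.continuous_occ (A := A) s)).indicator hm2
  have hi2 := (integrable_bz (B.continuous_occ (A := A) sᶜ)).indicator hm1
  have hi3 := B.integrable_occ_mul_eps_sub (A := A) s μ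
  have hi4 : Integrable ({k | eps d k < μ}.indicator fun k => μ - eps d k) (bz d) :=
    (integrable_bz (continuous_const.sub continuous_eps)).indicator hm3
  rw [mul_Rfun_sub_en, ← integral_indicator hm1, ← integral_indicator hm2,
    ← integral_indicator hm3, ← integral_add hi1 hi2, ← integral_const_mul,
    ← integral_const_mul, ← integral_add hi3 (hi4.const_mul _)]
  refine integral_mono ((hi1.add hi2).const_mul _) (hi3.add (hi4.const_mul _)) fun k => ?_
  have h0 := B.occ_nonneg (A := A) s k
  have h0' := B.occ_nonneg (A := A) sᶜ k
  simp only [← B.occ_add_occ_compl hA s k, Set.indicator_apply, Set.mem_ofPred_eq]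
  split_ifs <;> nlinarith

/-- A quantitative form of the Li–Yau bound with a boundary correction. -/
lemma exists_boundary_gain (hd : 0 < d) {μ : ℝ} (h0 : 0 < Rfun d μ) (h1 : Rfun d μ < 1) :
    ∃ α > 0, ∀ (Λ : Finset (Fin d → ℤ)) (V : (Fin d → ℤ) → ℝ) (B : EigenSystem Λ V)
      (A : Finset (Fin d → ℤ)) (s : Finset Λ), A ⊆ Λ →
      α * bdry (A : Set (Fin d → ℤ))
        ≤ ∫ k, B.occ A s k * (eps d k - μ) ∂(bz d) + A.card * (μ * Rfun d μ - en d μ) := by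
  have hd' : (0 : ℝ) < d := by exact_mod_cast hd
  have hen := en_neg h0 h1
  set c : ℝ := (en d μ / (2 * d)) ^ 2 with hc
  have hc0 : 0 < c := by
    have : en d μ / (2 * d) ≠ 0 := div_ne_zero hen.ne (by positivity)
    positivity
  obtain ⟨δ, hδ, hshell⟩ := exists_shell hd μ (c := c / 8) (by positivity)
  refine ⟨δ * c / (64 * d), by positivity, fun Λ V B A s hA => ?_⟩
  set D := ∫ k, B.occ A s k * (eps d k - μ) ∂(bz d) + A.card * (μ * Rfun d μ - en d μ) with hD
  have hfc (p : Fin d × Bool) : c ≤ ‖fc {k | eps d k < μ} (dir p)‖ ^ 2 := by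
    have hre : (fc {k | eps d k < μ} (dir p)).re = -en d μ / (2 * d) := by
      rw [fc_re]
      simp only [chr_dir_re]
      exact setIntegral_cos μ p.1
    calc c = |(fc {k | eps d k < μ} (dir p)).re| ^ 2 := by rw [hre, sq_abs, hc]; ring
      _ ≤ _ := by
        gcongr
        exact Complex.abs_re_le_norm _
  have hp (p : Fin d × Bool) :
      δ * c / 32 * (A.filter fun x => x + dir p ∉ A).card ≤ D := by
    have e1 := boundary_le_setIntegral_sfac A p μ δ c hδ.le (hfc p) hshell
    have e2 := B.setIntegral_sq_norm_trig_sub_le hA s {k | eps d k < μ - δ} {k | μ + δ < eps d k}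
    have e3 := B.mul_setIntegral_occ_le hA s μ hδ.le
    have e4 := mul_le_mul_of_nonneg_left (e1.trans (mul_le_mul_of_nonneg_left e2 zero_le_four))
      hδ.le
    linarith
  have hsum := Finset.sum_le_sum fun p (_ : p ∈ Finset.univ) => hp p
  rw [← Finset.mul_sum] at hsum
  simp only [Finset.sum_const, Finset.card_univ, Fintype.card_prod, Fintype.card_fin,
    Fintype.card_bool, nsmul_eq_mul] at hsum
  rw [bdry_eq_sum]
  push_cast at hsum ⊢
  rw [div_mul_eq_mul_div, div_le_iff₀ (by positivity)]
  linarith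

/-- The hopping from `A` applied to an eigenfunction. -/
noncomputable def EigenSystem.hop (B : EigenSystem Λ V) (A : Finset (Fin d → ℤ)) (i : Λ)
    (x : Fin d → ℤ) : ℝ := ∑ y ∈ A, adj x y * B.fn i y

lemma EigenSystem.integral_sq_norm_ft_mul_eps (i : Λ) :
    ∫ k, ‖B.ft A i k‖ ^ 2 * eps d k ∂(bz d) = -∑ x ∈ A, B.fn i x * B.hop A i x := by
  let u : (Fin d → ℤ) → ℝ := fun x => if x ∈ A then B.fn i x else 0
  have h := integral_sq_norm_trig_mul_eps A u fun x hx => if_neg hx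
  have h1 (k : Fin d → ℝ) : trig A (fun x => (u x : ℂ)) k = B.ft A i k :=
    Finset.sum_congr rfl fun x hx => by simp [u, hx]
  simp only [h1] at h
  rw [h]
  congr 1
  refine Finset.sum_congr rfl fun x hx => ?_
  rw [EigenSystem.hop, sum_adj_mul, Finset.mul_sum]
  exact Finset.sum_congr rfl fun p _ => by simp [u, hx]

lemma EigenSystem.integral_sq_norm_ft (i : Λ) :
    ∫ k, ‖B.ft A i k‖ ^ 2 ∂(bz d) = ∑ x ∈ A, B.fn i x ^ 2 := by
  simp only [EigenSystem.ft, integral_sq_norm_trig]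
  simp

lemma sum_mul_sum_adj_mul_le (C : Finset (Fin d → ℤ)) (f : (Fin d → ℤ) → ℝ) :
    ∑ x ∈ C, f x * ∑ y ∈ C, adj x y * f y ≤ 2 * d * ∑ x ∈ C, f x ^ 2 := by
  have hswap : ∑ x ∈ C, ∑ y ∈ C, adj x y * f y ^ 2 = ∑ x ∈ C, ∑ y ∈ C, adj x y * f x ^ 2 := by
    rw [Finset.sum_comm]
    exact Finset.sum_congr rfl fun x _ => Finset.sum_congr rfl fun y _ => by rw [adj_comm]
  calc ∑ x ∈ C, f x * ∑ y ∈ C, adj x y * f y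
      ≤ ∑ x ∈ C, ∑ y ∈ C, (adj x y * f x ^ 2 + adj x y * f y ^ 2) / 2 := by
        refine Finset.sum_le_sum fun x _ => ?_
        rw [Finset.mul_sum]
        refine Finset.sum_le_sum fun y _ => ?_
        nlinarith [mul_nonneg (adj_nonneg x y) (sq_nonneg (f x - f y))]
    _ = ∑ x ∈ C, ∑ y ∈ C, adj x y * f x ^ 2 := by
        simp only [← Finset.sum_div, Finset.sum_add_distrib, hswap]
        ring
    _ ≤ _ := by
        rw [Finset.mul_sum]
        refine Finset.sum_le_sum fun x _ => ?_
        rw [← Finset.sum_mul]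
        exact mul_le_mul_of_nonneg_right (sum_adj_le C x) (sq_nonneg _)

lemma EigenSystem.le_ev_sub (hA : A ⊆ Λ) {V0 μ : ℝ} (hκ : 0 < V0 - 2 * d - μ)
    (hV : ∀ x ∈ A, V x = 0) (hV0 : ∀ x ∈ Λ \ A, V0 ≤ V x) (i : Λ) :
    ∫ k, ‖B.ft A i k‖ ^ 2 * (eps d k - μ) ∂(bz d)
        - (∑ x ∈ Λ \ A, B.hop A i x ^ 2) / (V0 - 2 * d - μ) ≤ B.ev i - μ := by
  set κ := V0 - 2 * d - μ with hκ'
  have hnorm : ∑ x ∈ Λ \ A, B.fn i x ^ 2 + ∑ x ∈ A, B.fn i x ^ 2 = 1 := by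
    rw [Finset.sum_sdiff hA]
    simpa [← sq] using B.orth i i
  have hint : ∫ k, ‖B.ft A i k‖ ^ 2 * (eps d k - μ) ∂(bz d)
      = -∑ x ∈ A, B.fn i x * B.hop A i x - μ * ∑ x ∈ A, B.fn i x ^ 2 := by
    have hc : Continuous fun k => ‖B.ft A i k‖ ^ 2 := (B.continuous_ft i).norm.pow 2
    have hi1 : Integrable (fun k => ‖B.ft A i k‖ ^ 2 * eps d k) (bz d) :=
      integrable_bz (hc.mul continuous_eps)
    have hi2 : Integrable (fun k => ‖B.ft A i k‖ ^ 2 * μ) (bz d) :=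
      integrable_bz (hc.mul continuous_const)
    simp only [mul_sub]
    rw [integral_sub hi1 hi2, integral_mul_const, B.integral_sq_norm_ft_mul_eps,
      B.integral_sq_norm_ft]
    ring
  have hsplit (x : Fin d → ℤ) :
      ∑ y ∈ Λ, adj x y * B.fn i y = B.hop (Λ \ A) i x + B.hop A i x :=
    (Finset.sum_sdiff hA).symm
  have hev : B.ev i = ∑ x ∈ Λ, B.fn i x
      * (V x * B.fn i x - (B.hop (Λ \ A) i x + B.hop A i x)) := by
    have : B.ev i = ∑ x ∈ Λ, B.fn i x * (B.ev i * B.fn i x) := by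
      have h := B.orth i i
      rw [if_pos rfl] at h
      calc B.ev i = B.ev i * ∑ x ∈ Λ, B.fn i x * B.fn i x := by rw [h, mul_one]
        _ = _ := by
          rw [Finset.mul_sum]
          exact Finset.sum_congr rfl fun x _ => by ring
    rw [this]
    refine Finset.sum_congr rfl fun x hx => ?_
    rw [← B.eigen i x hx, hsplit]
  have hcross : ∑ x ∈ A, B.fn i x * B.hop (Λ \ A) i x
      = ∑ x ∈ Λ \ A, B.fn i x * B.hop A i x := by
    simp only [EigenSystem.hop, Finset.mul_sum]
    rw [Finset.sum_comm]
    refine Finset.sum_congr rfl fun x _ => Finset.sum_congr rfl fun y _ => ?_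
    rw [adj_comm]
    ring
  have hAA : ∑ x ∈ A, B.fn i x * (V x * B.fn i x - (B.hop (Λ \ A) i x + B.hop A i x))
      = -∑ x ∈ A, B.fn i x * B.hop (Λ \ A) i x - ∑ x ∈ A, B.fn i x * B.hop A i x := by
    rw [← Finset.sum_neg_distrib, ← Finset.sum_sub_distrib]
    exact Finset.sum_congr rfl fun x hx => by rw [hV x hx]; ring
  have hCC := sum_mul_sum_adj_mul_le (Λ \ A) (B.fn i)
  have hpt : -(∑ x ∈ Λ \ A, B.hop A i x ^ 2) / κ
      ≤ ∑ x ∈ Λ \ A, (κ * B.fn i x ^ 2 - 2 * (B.fn i x * B.hop A i x)) := by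
    rw [neg_div, Finset.sum_div, ← Finset.sum_neg_distrib]
    refine Finset.sum_le_sum fun x _ => ?_
    have : κ * B.fn i x ^ 2 - 2 * (B.fn i x * B.hop A i x) + B.hop A i x ^ 2 / κ
        = (κ * B.fn i x - B.hop A i x) ^ 2 / κ := by
      field_simp
      ring
    have : 0 ≤ (κ * B.fn i x - B.hop A i x) ^ 2 / κ := by positivity
    linarith
  have hCV : ∑ x ∈ Λ \ A, B.fn i x * (V x * B.fn i x - (B.hop (Λ \ A) i x + B.hop A i x))
      ≥ V0 * ∑ x ∈ Λ \ A, B.fn i x ^ 2 - ∑ x ∈ Λ \ A, B.fn i x * B.hop (Λ \ A) i x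
        - ∑ x ∈ Λ \ A, B.fn i x * B.hop A i x := by
    rw [Finset.mul_sum, ← Finset.sum_sub_distrib, ← Finset.sum_sub_distrib]
    refine Finset.sum_le_sum fun x hx => ?_
    nlinarith [mul_le_mul_of_nonneg_right (hV0 x hx) (sq_nonneg (B.fn i x))]
  rw [← Finset.sum_sdiff hA, hAA, hcross] at hev
  rw [Finset.sum_sub_distrib, ← Finset.mul_sum, ← Finset.mul_sum, neg_div] at hpt
  change ∑ x ∈ Λ \ A, B.fn i x * B.hop (Λ \ A) i x ≤ _ at hCC
  rw [hint, hev]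
  have hμ : μ = μ * ∑ x ∈ Λ \ A, B.fn i x ^ 2 + μ * ∑ x ∈ A, B.fn i x ^ 2 := by
    rw [← mul_add, hnorm, mul_one]
  rw [hκ', sub_mul, sub_mul] at hpt
  rw [← hκ'] at hpt
  linarith

lemma EigenSystem.sum_sq_hop (hA : A ⊆ Λ) (x : Fin d → ℤ) :
    ∑ i, B.hop A i x ^ 2 = ∑ y ∈ A, adj x y := by
  calc ∑ i, B.hop A i x ^ 2
      = ∑ i, ∑ y ∈ A, ∑ z ∈ A, adj x y * adj x z * (B.fn i y * B.fn i z) := by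
        refine Finset.sum_congr rfl fun i _ => ?_
        rw [sq, EigenSystem.hop, Finset.sum_mul_sum]
        exact Finset.sum_congr rfl fun y _ => Finset.sum_congr rfl fun z _ => by ring
    _ = ∑ y ∈ A, ∑ z ∈ A, adj x y * adj x z * (if y = z then 1 else 0) := by
        rw [Finset.sum_comm]
        refine Finset.sum_congr rfl fun y hy => ?_
        rw [Finset.sum_comm]
        refine Finset.sum_congr rfl fun z hz => ?_
        rw [← Finset.mul_sum, B.complete y (hA hy) z (hA hz)]
    _ = _ := by
        refine Finset.sum_congr rfl fun y hy => ?_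
        simp only [mul_ite, mul_one, mul_zero, Finset.sum_ite_eq, hy, if_true]
        rw [adj]
        split_ifs <;> norm_num

lemma EigenSystem.le_sum_ev_sub (hA : A ⊆ Λ) {V0 μ : ℝ} (hκ : 0 < V0 - 2 * d - μ)
    (hV : ∀ x ∈ A, V x = 0) (hV0 : ∀ x ∈ Λ \ A, V0 ≤ V x) (s : Finset Λ) :
    ∫ k, B.occ A s k * (eps d k - μ) ∂(bz d)
        - bdry (A : Set (Fin d → ℤ)) / (V0 - 2 * d - μ) ≤ ∑ i ∈ s, B.ev i - μ * s.card := by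
  have h := Finset.sum_le_sum fun i (_ : i ∈ s) => B.le_ev_sub hA hκ hV hV0 i
  rw [Finset.sum_sub_distrib, Finset.sum_sub_distrib, ← Finset.sum_div, Finset.sum_const,
    nsmul_eq_mul, mul_comm _ μ] at h
  refine le_trans ?_ h
  have hint : ∫ k, B.occ A s k * (eps d k - μ) ∂(bz d)
      = ∑ i ∈ s, ∫ k, ‖B.ft A i k‖ ^ 2 * (eps d k - μ) ∂(bz d) := by
    simp only [EigenSystem.occ, Finset.sum_mul]
    exact integral_finsetSum _ fun i _ => integrable_bz
      (((B.continuous_ft i).norm.pow 2).mul (continuous_eps.sub continuous_const))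
  rw [hint]
  gcongr
  calc ∑ i ∈ s, ∑ x ∈ Λ \ A, B.hop A i x ^ 2
      ≤ ∑ i, ∑ x ∈ Λ \ A, B.hop A i x ^ 2 :=
        Finset.sum_le_univ_sum_of_nonneg fun i => Finset.sum_nonneg fun x _ => sq_nonneg _
    _ = ∑ x ∈ Λ \ A, ∑ y ∈ A, adj x y := by
        rw [Finset.sum_comm]
        exact Finset.sum_congr rfl fun x _ => B.sum_sq_hop hA x
    _ ≤ _ := sum_sum_adj_sdiff_le A (Λ \ A) Finset.disjoint_sdiff

end LowerBound

section UpperBound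

variable {d : ℕ} {Λ : Finset (Fin d → ℤ)} {V : (Fin d → ℤ) → ℝ} (B : EigenSystem Λ V)
  {A : Finset (Fin d → ℤ)}

lemma EigenSystem.sum_ev_mul (x y : Fin d → ℤ) (hx : x ∈ Λ) (hy : y ∈ Λ) :
    ∑ i, B.ev i * (B.fn i x * B.fn i y) = V x * (if x = y then 1 else 0) - adj x y := by
  calc ∑ i, B.ev i * (B.fn i x * B.fn i y)
      = ∑ i, (V x * (B.fn i x * B.fn i y) - ∑ z ∈ Λ, adj x z * (B.fn i z * B.fn i y)) := by
        refine Finset.sum_congr rfl fun i _ => ?_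
        rw [← mul_assoc, ← B.eigen i x hx, sub_mul, Finset.sum_mul, mul_assoc]
        simp only [mul_assoc]
    _ = V x * (if x = y then 1 else 0) - ∑ z ∈ Λ, adj x z * (if z = y then 1 else 0) := by
        rw [Finset.sum_sub_distrib, ← Finset.mul_sum, B.complete x hx y hy, Finset.sum_comm]
        congr 1
        refine Finset.sum_congr rfl fun z hz => ?_
        rw [← Finset.mul_sum, B.complete z hz y hy]
    _ = _ := by simp [hy]

lemma EigenSystem.setIntegral_sq_norm_ft (S : Set (Fin d → ℝ)) (i : Λ) :
    ∫ k in S, ‖B.ft A i k‖ ^ 2 ∂(bz d)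
      = ∑ x ∈ A, ∑ y ∈ A, B.fn i x * B.fn i y * (fc S (x - y)).re := by
  have h := congrArg Complex.re (setIntegral_sq_norm_trig S A fun x => (B.fn i x : ℂ))
  rw [Complex.ofReal_re] at h
  simp only [EigenSystem.ft]
  rw [h]
  simp only [Complex.re_sum, Complex.conj_ofReal, ← Complex.ofReal_mul, Complex.re_ofReal_mul]

/-- The energy of the trial occupation numbers given by the Fermi sea. -/
lemma EigenSystem.sum_ev_mul_setIntegral (hd : 0 < d) (hA : A ⊆ Λ) (hV : ∀ x ∈ A, V x = 0)
    (μ : ℝ) :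
    ∑ i, B.ev i * ∫ k in {k | eps d k < μ}, ‖B.ft A i k‖ ^ 2 ∂(bz d)
      = en d μ * A.card - en d μ / (2 * d) * bdry (A : Set (Fin d → ℤ)) := by
  have hd' : (d : ℝ) ≠ 0 := Nat.cast_ne_zero.mpr hd.ne'
  have hfc (x y : Fin d → ℤ) : adj x y * (fc {k | eps d k < μ} (x - y)).re
      = adj x y * (-en d μ / (2 * d)) := by
    by_cases h : dist1 y x = 1
    · obtain ⟨p, rfl⟩ := (dist1_eq_one_iff y x).mp h
      rw [add_sub_cancel_left, fc_re]
      simp only [chr_dir_re, setIntegral_cos]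
    · rw [adj_comm, adj, if_neg h, zero_mul, zero_mul]
  calc ∑ i, B.ev i * ∫ k in {k | eps d k < μ}, ‖B.ft A i k‖ ^ 2 ∂(bz d)
      = ∑ i, ∑ x ∈ A, ∑ y ∈ A, B.ev i * (B.fn i x * B.fn i y)
          * (fc {k | eps d k < μ} (x - y)).re := by
        refine Finset.sum_congr rfl fun i _ => ?_
        rw [B.setIntegral_sq_norm_ft, Finset.mul_sum]
        refine Finset.sum_congr rfl fun x _ => ?_
        rw [Finset.mul_sum]
        exact Finset.sum_congr rfl fun y _ => by ring
    _ = ∑ x ∈ A, ∑ y ∈ A, -(adj x y * (-en d μ / (2 * d))) := by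
        rw [Finset.sum_comm]
        refine Finset.sum_congr rfl fun x hx => ?_
        rw [Finset.sum_comm]
        refine Finset.sum_congr rfl fun y hy => ?_
        rw [← Finset.sum_mul, B.sum_ev_mul x y (hA hx) (hA hy), hV x hx, zero_mul, zero_sub,
          neg_mul, hfc]
    _ = _ := by
        simp only [Finset.sum_neg_distrib, ← Finset.sum_mul, sum_sum_adj]
        field_simp

lemma EigenSystem.sum_setIntegral (hA : A ⊆ Λ) (μ : ℝ) :
    ∑ i, ∫ k in {k | eps d k < μ}, ‖B.ft A i k‖ ^ 2 ∂(bz d) = A.card * Rfun d μ := by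
  have hocc (k : Fin d → ℝ) : ∑ i, ‖B.ft A i k‖ ^ 2 = A.card := by
    have h := B.occ_add_occ_compl hA Finset.univ k
    rwa [Finset.compl_univ, EigenSystem.occ, EigenSystem.occ, Finset.sum_empty, add_zero] at h
  have hi (i : Λ) : IntegrableOn (fun k => ‖B.ft A i k‖ ^ 2) {k | eps d k < μ} (bz d) :=
    (integrable_bz ((B.continuous_ft i).norm.pow 2)).integrableOn
  rw [← integral_finsetSum _ fun i _ => hi i, Rfun_eq]
  simp only [hocc]
  rw [setIntegral_const, smul_eq_mul, mul_comm]

lemma EigenSystem.setIntegral_sq_norm_ft_le_one (hA : A ⊆ Λ) (S : Set (Fin d → ℝ)) (i : Λ) :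
    ∫ k in S, ‖B.ft A i k‖ ^ 2 ∂(bz d) ≤ 1 := by
  refine (setIntegral_sq_norm_trig_le S A _).trans ?_
  have h := B.orth i i
  rw [if_pos rfl] at h
  rw [← h]
  refine (Finset.sum_le_sum_of_subset_of_nonneg hA fun x _ _ => by positivity).trans
    (le_of_eq ?_)
  exact Finset.sum_congr rfl fun x _ => by simp [sq]

/-- The bathtub principle for finite sums. -/
lemma exists_card_eq_sum_le {ι : Type*} [Fintype ι] (v w : ι → ℝ) (h0 : ∀ i, 0 ≤ w i)
    (h1 : ∀ i, w i ≤ 1) {N : ℕ} (hN : ∑ i, w i = N) :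
    ∃ s : Finset ι, s.card = N ∧ ∑ i ∈ s, v i ≤ ∑ i, v i * w i := by
  have hcard : N ≤ Fintype.card ι := by
    have : (N : ℝ) ≤ ∑ _i : ι, (1 : ℝ) := hN ▸ Finset.sum_le_sum fun i _ => h1 i
    simpa using this
  obtain ⟨s, hs, hmin⟩ := (Set.toFinite {s : Finset ι | s.card = N}).exists_minimalFor
    (fun s => ∑ i ∈ s, v i) _ (nonempty_card_eq hcard)
  refine ⟨s, hs, ?_⟩
  have hswap (i : ι) (hi : i ∈ s) (j : ι) (hj : j ∉ s) : v i ≤ v j := by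
    by_contra! hlt
    have hj' : j ∉ s.erase i := fun h => hj (Finset.mem_of_mem_erase h)
    have hle := hmin (j := insert j (s.erase i)) (by
      change (insert j (s.erase i)).card = N
      rw [Finset.card_insert_of_notMem hj', Finset.card_erase_add_one hi]
      exact hs)
    simp only [Finset.sum_insert hj', ← Finset.add_sum_erase s v hi] at hle
    linarith [hle (by linarith)]
  obtain ⟨t, ht1, ht2⟩ : ∃ t, (∀ i ∈ s, v i ≤ t) ∧ ∀ j ∉ s, t * w j ≤ v j * w j := by
    rcases s.eq_empty_or_nonempty with rfl | hne
    · have hz : ∑ i, w i = 0 := by rw [hN, ← hs]; simp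
      refine ⟨0, by simp, fun j _ => ?_⟩
      rw [(Finset.sum_eq_zero_iff_of_nonneg fun i _ => h0 i).mp hz j (Finset.mem_univ j)]
      simp
    · obtain ⟨i, hi, hmax⟩ := s.exists_max_image v hne
      exact ⟨v i, hmax, fun j hj => mul_le_mul_of_nonneg_right (hswap i hi j hj) (h0 j)⟩
  have e1 : ∑ i ∈ s, v i ≤ ∑ i ∈ s, (v i * w i + t * (1 - w i)) :=
    Finset.sum_le_sum fun i hi => by nlinarith [ht1 i hi, h1 i]
  have e2 : ∑ j ∈ sᶜ, t * w j ≤ ∑ j ∈ sᶜ, v j * w j :=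
    Finset.sum_le_sum fun j hj => ht2 j (Finset.mem_compl.mp hj)
  rw [← Finset.sum_add_sum_compl s] at hN ⊢
  rw [Finset.sum_add_distrib, ← Finset.mul_sum, Finset.sum_sub_distrib, Finset.sum_const,
    nsmul_eq_mul, mul_one, hs] at e1
  rw [← Finset.mul_sum] at e2
  have e3 : t * (N - ∑ i ∈ s, w i) = t * ∑ j ∈ sᶜ, w j := by rw [← hN]; ring
  linarith

lemma Aset_subset (Λ : Finset (Fin d → ℤ)) (V : (Fin d → ℤ) → ℝ) : Aset d Λ V ⊆ Λ :=
  Finset.filter_subset _ _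

lemma eq_zero_of_mem_Aset (x : Fin d → ℤ) (hx : x ∈ Aset d Λ V) : V x = 0 :=
  (Finset.mem_filter.mp hx).2

lemma bddBelow_energies (Λ : Finset (Fin d → ℤ)) (Vup Vdn : (Fin d → ℤ) → ℝ) (N : ℕ) :
    BddBelow {r : ℝ | ∃ Nup Ndn : ℕ, Nup + Ndn = N ∧ Nup ≤ Λ.card ∧ Ndn ≤ Λ.card ∧
      r = SN d Λ Vup Nup + SN d Λ Vdn Ndn} := by
  refine ((Set.toFinite (Set.Iic Λ.card ×ˢ Set.Iic Λ.card)).image fun q : ℕ × ℕ =>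
    SN d Λ Vup q.1 + SN d Λ Vdn q.2).bddBelow.mono ?_
  rintro _ ⟨a, b, -, ha, hb, rfl⟩
  exact ⟨(a, b), ⟨ha, hb⟩, rfl⟩

lemma EN_le (hd : 0 < d) (Λ : Finset (Fin d → ℤ)) (Vup Vdn : (Fin d → ℤ) → ℝ) {N : ℕ} {μ : ℝ}
    (hN : (N : ℝ) = ((Aset d Λ Vup).card + (Aset d Λ Vdn).card) * Rfun d μ) :
    EN d Λ Vup Vdn N ≤ en d μ * ((Aset d Λ Vup).card + (Aset d Λ Vdn).card)
      - en d μ / (2 * d) * (bdry (Aset d Λ Vup : Set (Fin d → ℤ))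
        + bdry (Aset d Λ Vdn : Set (Fin d → ℤ))) := by
  obtain ⟨B⟩ := exists_eigenSystem Λ Vup
  obtain ⟨C⟩ := exists_eigenSystem Λ Vdn
  have hB := Aset_subset Λ Vup
  have hC := Aset_subset Λ Vdn
  let S : Set (Fin d → ℝ) := {k | eps d k < μ}
  let w : Λ ⊕ Λ → ℝ := Sum.elim (fun i => ∫ k in S, ‖B.ft (Aset d Λ Vup) i k‖ ^ 2 ∂(bz d))
    fun i => ∫ k in S, ‖C.ft (Aset d Λ Vdn) i k‖ ^ 2 ∂(bz d)
  have hw0 (i : Λ ⊕ Λ) : 0 ≤ w i := by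
    rcases i with i | i <;> exact integral_nonneg fun k => by positivity
  have hw1 (i : Λ ⊕ Λ) : w i ≤ 1 := by
    rcases i with i | i
    · exact B.setIntegral_sq_norm_ft_le_one hB S i
    · exact C.setIntegral_sq_norm_ft_le_one hC S i
  have hwN : ∑ i, w i = N := by
    rw [Fintype.sum_sum_type, hN, add_mul]
    exact congrArg₂ _ (B.sum_setIntegral hB μ) (C.sum_setIntegral hC μ)
  obtain ⟨s, hs, hle⟩ := exists_card_eq_sum_le (Sum.elim B.ev C.ev) w hw0 hw1 hwN
  have hE : ∑ i, Sum.elim B.ev C.ev i * w i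
      = (en d μ * (Aset d Λ Vup).card
          - en d μ / (2 * d) * bdry (Aset d Λ Vup : Set (Fin d → ℤ)))
        + (en d μ * (Aset d Λ Vdn).card
          - en d μ / (2 * d) * bdry (Aset d Λ Vdn : Set (Fin d → ℤ))) := by
    rw [Fintype.sum_sum_type]
    exact congrArg₂ _ (B.sum_ev_mul_setIntegral hd hB eq_zero_of_mem_Aset μ)
      (C.sum_ev_mul_setIntegral hd hC eq_zero_of_mem_Aset μ)
  rw [hE, Finset.sum_sum_eq_sum_toLeft_add_sum_toRight] at hle
  have hEN : EN d Λ Vup Vdn N ≤ SN d Λ Vup s.toLeft.card + SN d Λ Vdn s.toRight.card := by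
    refine csInf_le (bddBelow_energies Λ Vup Vdn N) ⟨_, _, ?_, ?_, ?_, rfl⟩
    · rw [Finset.card_toLeft_add_card_toRight, hs]
    · simpa using Finset.card_le_univ s.toLeft
    · simpa using Finset.card_le_univ s.toRight
  have h1 := B.SN_le s.toLeft
  have h2 := C.SN_le s.toRight
  simp only [Sum.elim_inl, Sum.elim_inr] at hle
  linarith

end UpperBound

section Main

variable {d : ℕ}

lemma inv_le_gam (hd : 2 ≤ d) {V0 μ : ℝ} (hV0 : 2 * (d : ℝ) * (√d + 1) < V0)
    (hμ : μ < 2 * d) : 0 < V0 - 2 * d - μ ∧ 1 / (V0 - 2 * d - μ) ≤ gam d V0 := by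
  have hd' : (2 : ℝ) ≤ d := by exact_mod_cast hd
  have hs : (√d : ℝ) ^ 2 = d := Real.sq_sqrt (by linarith)
  have hs' : (1.4 : ℝ) ≤ √d := Real.le_sqrt_of_sq_le (by norm_num; linarith)
  have hW : 2 * d * √d < V0 - 2 * d := by linarith
  set W := V0 - 2 * d with hWdef
  have hW1 : 2.8 * d ≤ W := by nlinarith
  have hW2 : 4 * (d : ℝ) ^ 3 < W ^ 2 := by
    have h : (2 * d * √d : ℝ) ^ 2 = 4 * (d : ℝ) ^ 3 := by rw [mul_pow, hs]; ring
    rw [← h]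
    gcongr
  have hW0 : 0 < W := by nlinarith
  refine ⟨by linarith, ?_⟩
  have h1 : 1 / (W - μ) ≤ 4 * d / W := by
    rw [div_le_div_iff₀ (by linarith) hW0]
    nlinarith
  have h2 : 0 ≤ 16 * (d : ℝ) ^ 3 / (W ^ 2 - 4 * (d : ℝ) ^ 3) :=
    div_nonneg (by positivity) (by linarith)
  rw [gam]
  linarith

lemma le_SN (hd : 2 ≤ d) {Λ : Finset (Fin d → ℤ)} {V : (Fin d → ℤ) → ℝ} {V0 μ α : ℝ}
    (hV : ∀ x ∈ Λ, V x ≠ 0 → V0 ≤ V x) (hV0 : 2 * (d : ℝ) * (√d + 1) < V0) (hμ : μ < 2 * d)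
    (hα : ∀ (B : EigenSystem Λ V) (s : Finset Λ),
      α * bdry (Aset d Λ V : Set (Fin d → ℤ))
        ≤ ∫ k, B.occ (Aset d Λ V) s k * (eps d k - μ) ∂(bz d)
          + (Aset d Λ V).card * (μ * Rfun d μ - en d μ))
    {N : ℕ} (hN : N ≤ Λ.card) :
    μ * N - (Aset d Λ V).card * (μ * Rfun d μ - en d μ)
        + (α - gam d V0) * bdry (Aset d Λ V : Set (Fin d → ℤ)) ≤ SN d Λ V N := by
  obtain ⟨B⟩ := exists_eigenSystem Λ V
  obtain ⟨hκ, hgam⟩ := inv_le_gam hd hV0 hμ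
  refine B.le_SN hN fun s hs => ?_
  have h1 := hα B s
  have h2 := B.le_sum_ev_sub (Aset_subset Λ V) hκ eq_zero_of_mem_Aset (fun x hx => by
    obtain ⟨hx1, hx2⟩ := Finset.mem_sdiff.mp hx
    exact hV x hx1 fun h => hx2 (Finset.mem_filter.mpr ⟨hx1, h⟩)) s
  have h3 := mul_le_mul_of_nonneg_right hgam
    (Nat.cast_nonneg (α := ℝ) (bdry (Aset d Λ V : Set (Fin d → ℤ))))
  rw [hs] at h2
  rw [one_div_mul_eq_div] at h3
  linarith

end Main

/-- Proposition 3 (non-interacting form): for `d ≥ 2` there is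
`ᾱ : (0,1) → (0,∞)`, depending only on `d`, such that for every magnetic
potential with `A_↑ ∩ A_↓ = ∅`, gap `V₀ > 2d(√d + 1)`, and `0 < N ≤ |A|` with
`ρ = N/|A| < 1`,
`e(ρ)|A| - (e(ρ)/2d)(B(A_↑)+B(A_↓)) ≥ E(N) ≥ e(ρ)|A| + (ᾱ(ρ) - γ(V₀))(B(A_↑)+B(A_↓))`. -/
theorem stmt15 (d : ℕ) (hd : 2 ≤ d) (εF e : ℝ → ℝ)
    (hεF : ∀ ρ ∈ Set.Ioo (0:ℝ) 1,
      εF ρ ∈ Set.Ioo (-(2*(d:ℝ))) (2*(d:ℝ)) ∧ Rfun d (εF ρ) = ρ)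
    (he : ∀ ρ ∈ Set.Ioo (0:ℝ) 1, e ρ = en d (εF ρ)) :
    ∃ αbar : ℝ → ℝ, (∀ ρ ∈ Set.Ioo (0:ℝ) 1, 0 < αbar ρ) ∧
      ∀ (Λ : Finset (Fin d → ℤ)) (Vup Vdn : (Fin d → ℤ) → ℝ),
        (∀ x ∈ Λ, 0 ≤ Vup x) → (∀ x ∈ Λ, 0 ≤ Vdn x) →
        Aset d Λ Vup ∩ Aset d Λ Vdn = ∅ →
        (Aset d Λ Vup).Nonempty → (Aset d Λ Vdn).Nonempty →
        ∀ V0 : ℝ,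
        (∀ x ∈ Λ, (Vup x ≠ 0 → V0 ≤ Vup x) ∧ (Vdn x ≠ 0 → V0 ≤ Vdn x)) →
        2*(d:ℝ)*(Real.sqrt d + 1) < V0 →
        ∀ N : ℕ, 0 < N → N ≤ (Aset d Λ Vup ∪ Aset d Λ Vdn).card →
        (N : ℝ) / ((Aset d Λ Vup ∪ Aset d Λ Vdn).card : ℝ) < 1 →
        (e ((N : ℝ) / ((Aset d Λ Vup ∪ Aset d Λ Vdn).card : ℝ))
            * ((Aset d Λ Vup ∪ Aset d Λ Vdn).card : ℝ)
          - e ((N : ℝ) / ((Aset d Λ Vup ∪ Aset d Λ Vdn).card : ℝ)) / (2*(d:ℝ))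
            * ((bdry (↑(Aset d Λ Vup) : Set (Fin d → ℤ)) : ℝ)
              + (bdry (↑(Aset d Λ Vdn) : Set (Fin d → ℤ)) : ℝ))
          ≥ EN d Λ Vup Vdn N) ∧
        (EN d Λ Vup Vdn N ≥
          e ((N : ℝ) / ((Aset d Λ Vup ∪ Aset d Λ Vdn).card : ℝ))
            * ((Aset d Λ Vup ∪ Aset d Λ Vdn).card : ℝ)
          + (αbar ((N : ℝ) / ((Aset d Λ Vup ∪ Aset d Λ Vdn).card : ℝ)) - gam d V0)
            * ((bdry (↑(Aset d Λ Vup) : Set (Fin d → ℤ)) : ℝ)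
              + (bdry (↑(Aset d Λ Vdn) : Set (Fin d → ℤ)) : ℝ))) := by
  have hd0 : 0 < d := by omega
  have hgain : ∀ ρ ∈ Set.Ioo (0 : ℝ) 1, ∃ α > 0, ∀ (Λ : Finset (Fin d → ℤ))
      (V : (Fin d → ℤ) → ℝ) (B : EigenSystem Λ V) (A : Finset (Fin d → ℤ)) (s : Finset Λ),
      A ⊆ Λ → α * bdry (A : Set (Fin d → ℤ))
        ≤ ∫ k, B.occ A s k * (eps d k - εF ρ) ∂(bz d)
          + A.card * (εF ρ * Rfun d (εF ρ) - en d (εF ρ)) := by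
    intro ρ hρ
    have hR := (hεF ρ hρ).2
    exact exists_boundary_gain hd0 (hρ.1.trans_eq hR.symm) (hR.trans_lt hρ.2)
  choose! αbar hα0 hα using hgain
  refine ⟨αbar, hα0, ?_⟩
  intro Λ Vup Vdn _ _ hdisj hup _ V0 hV hV0 N hN hNA hρ1
  have hcard : ((Aset d Λ Vup ∪ Aset d Λ Vdn).card : ℝ)
      = (Aset d Λ Vup).card + (Aset d Λ Vdn).card := by
    rw [Finset.card_union_of_disjoint (Finset.disjoint_iff_inter_eq_empty.mpr hdisj)]
    push_cast
    rfl
  have hpos : (0 : ℝ) < (Aset d Λ Vup ∪ Aset d Λ Vdn).card := by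
    exact_mod_cast (hup.mono Finset.subset_union_left).card_pos
  set ρ : ℝ := (N : ℝ) / ((Aset d Λ Vup ∪ Aset d Λ Vdn).card : ℝ) with hρ
  have hρm : ρ ∈ Set.Ioo (0 : ℝ) 1 := ⟨div_pos (by exact_mod_cast hN) hpos, hρ1⟩
  obtain ⟨⟨-, hμ⟩, hR⟩ := hεF ρ hρm
  have hNρ : (N : ℝ) = ((Aset d Λ Vup).card + (Aset d Λ Vdn).card) * Rfun d (εF ρ) := by
    rw [hR, ← hcard, hρ, mul_div_cancel₀ _ hpos.ne']
  rw [he ρ hρm, hcard]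
  refine ⟨EN_le hd0 Λ Vup Vdn hNρ, ?_⟩
  refine le_csInf ?_ ?_
  · have hle : N ≤ Λ.card := hNA.trans
      (Finset.card_le_card (Finset.union_subset (Aset_subset Λ Vup) (Aset_subset Λ Vdn)))
    exact ⟨_, N, 0, add_zero N, hle, Nat.zero_le _, rfl⟩
  · rintro _ ⟨Nup, Ndn, hsum, hNup, hNdn, rfl⟩
    have h1 := le_SN hd (fun x hx => (hV x hx).1) hV0 hμ
      (fun B s => hα ρ hρm Λ Vup B _ s (Aset_subset Λ Vup)) hNup
    have h2 := le_SN hd (fun x hx => (hV x hx).2) hV0 hμ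
      (fun B s => hα ρ hρm Λ Vdn B _ s (Aset_subset Λ Vdn)) hNdn
    have h3 : εF ρ * (Nup + Ndn) = εF ρ * N := by rw [← hsum]; push_cast; rfl
    rw [hNρ] at h3
    linarith
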